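/- Let L = ⋃_{i=0}^{m₀} K_i be a compact subset of ℂ with connected complement, where m₀ ≥ 1 and K₀, …, K_{m₀} are the connected components of L, K₀ has nonempty interior, and each K_i with 1 ≤ i ≤ m₀ contains more than one point. Let Π := L ∖ K₀ = ⋃_{i=1}^{m₀} K_i, and fix z₀ in the interior of K₀. Let (β_n)_{n≥1} be a sequence of complex numbers such that the sequence (|β_n|^{1/n})_{n≥1} has a limit point in the open interval (ρ_L, 1/ρ_L). Then U(z₀, K₀, Π, (β_n)) is a dense G_δ subset of (A(K₀), ‖·‖_{K₀}); in particular U(z₀, K₀, Π, (β_n)) ≠ ∅. -/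

import Mathlib

open Filter Topology Metric

/-- The `n`-th partial sum of the Taylor series of `f` at `z₀`:
`S_n(f,z₀)(z) = Σ_{k=0}^{n} (f^{(k)}(z₀)/k!)·(z−z₀)^k`. -/
noncomputable def taylorSum (f : ℂ → ℂ) (z₀ : ℂ) (n : ℕ) (z : ℂ) : ℂ :=
  ∑ k ∈ Finset.range (n + 1), (iteratedDeriv k f z₀ / (Nat.factorial k)) * (z - z₀) ^ k

/-- Supremum norm of `g` on `X`. -/
noncomputable def supNorm (g : ℂ → ℂ) (X : Set ℂ) : ℝ :=
  sSup ((fun z => ‖g z‖) '' X)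

/-- Membership in `A(X)`: continuous on `X` and holomorphic on the interior of `X`. -/
def memA (X : Set ℂ) (f : ℂ → ℂ) : Prop :=
  ContinuousOn f X ∧ DifferentiableOn ℂ f (interior X)

/-- The universal class `U(z₀, K₀, Π, (β_n))`: elements `f` of `A(K₀)` such that
`{β_n · S_n(f, z₀)|_Π : n ≥ 1}` is dense in `A(Π)` for the sup norm on `Π`. -/
def Uuniv (z₀ : ℂ) (K₀ P : Set ℂ) (β : ℕ → ℂ) : Set (ℂ → ℂ) :=
  {f | memA K₀ f ∧ ∀ h : ℂ → ℂ, memA P h → ∀ ε : ℝ, 0 < ε →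
    ∃ n : ℕ, 1 ≤ n ∧ supNorm (fun z => β n * taylorSum f z₀ n z - h z) P < ε}

/-- Best sup-norm approximation error of `G` on `L` by polynomials of degree at most `n`. -/
noncomputable def dApprox (L : Set ℂ) (G : ℂ → ℂ) (n : ℕ) : ℝ :=
  sInf {c : ℝ | ∃ p : Polynomial ℂ, p.degree ≤ (n : ℕ) ∧
    c = supNorm (fun z => G z - Polynomial.eval z p) L}

/-- The asymptotic quantity `limsup_n d_n(G)^{1/n}`; for a function `G` which is equal to a
different polynomial on each connected component of `L` this is the asymptotic convergence
factor `ρ_L` of `L`. -/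
noncomputable def rho (L : Set ℂ) (G : ℂ → ℂ) : ℝ :=
  Filter.limsup (fun n : ℕ => dApprox L G n ^ (1 / (n : ℝ))) Filter.atTop

/-- `W` is open in the subspace `A(X)`, with respect to the sup-norm on `X`. -/
def openInA (X : Set ℂ) (W : Set (ℂ → ℂ)) : Prop :=
  ∀ f ∈ W, memA X f →
    ∃ ε > (0:ℝ), ∀ g : ℂ → ℂ, memA X g → supNorm (fun z => g z - f z) X < ε → g ∈ W

/-- `S` is dense in `A(X)`, with respect to the sup-norm on `X`. -/
def denseInA (X : Set ℂ) (S : Set (ℂ → ℂ)) : Prop :=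
  ∀ g : ℂ → ℂ, memA X g → ∀ ε : ℝ, 0 < ε → ∃ f ∈ S, supNorm (fun z => f z - g z) X < ε


open Polynomial in
theorem cheb_sum (n : ℕ) (θ : ℝ) (hθ : 0 ≤ θ) :
    ∑ i ∈ Finset.range (n+1), ∏ j ∈ (Finset.range (n+1)).erase i,
      ((Real.cosh θ - Polynomial.Chebyshev.node n j) /
        |Polynomial.Chebyshev.node n i - Polynomial.Chebyshev.node n j|) ≤ Real.exp θ ^ n := by
  have hinj : Set.InjOn (Polynomial.Chebyshev.node n) (Finset.range (n+1) : Finset ℕ) :=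
    (Polynomial.Chebyshev.strictAntiOn_node n).injOn
  have hT := Lagrange.eq_interpolate (f := Chebyshev.T ℝ n) hinj (by
    rw [Finset.card_range, Chebyshev.degree_T]; simp; norm_cast; omega)
  have h2 : (Chebyshev.T ℝ n).eval (Real.cosh θ) = Real.cosh (n * θ) := by
    simp
  have h3 : Real.cosh (n * θ) ≤ Real.exp θ ^ n := by
    rw [← Real.exp_nat_mul, Real.cosh_eq]
    have : Real.exp (-(n * θ)) ≤ Real.exp (n * θ) := Real.exp_le_exp.2 (by
      have : 0 ≤ n * θ := by positivity
      linarith)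
    linarith
  refine le_trans (le_of_eq ?_) h3
  rw [← h2, hT, Lagrange.interpolate_apply, eval_finsetSum]
  refine Finset.sum_congr rfl fun i hi => ?_
  have hi' : i ≤ n := by simpa [Nat.lt_succ_iff] using hi
  rw [eval_mul, eval_C, Chebyshev.eval_T_real_node (by simpa using hi'), Lagrange.basis, eval_prod]
  simp only [Lagrange.basisDivisor, eval_mul, eval_C, eval_sub, eval_X]
  rw [Finset.prod_div_distrib, Finset.prod_mul_distrib, Finset.prod_inv_distrib, ← Finset.abs_prod]
  have hp := Chebyshev.zero_lt_prod_node_sub_node hi'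
  have : |∏ j ∈ (Finset.range (n+1)).erase i, (Chebyshev.node n i - Chebyshev.node n j)|
      = (-1) ^ i * ∏ j ∈ (Finset.range (n+1)).erase i, (Chebyshev.node n i - Chebyshev.node n j) := by
    rw [← abs_of_pos hp, abs_mul]; simp
  rw [this]
  set Q := ∏ j ∈ (Finset.range (n+1)).erase i, (Chebyshev.node n i - Chebyshev.node n j)
  have hQ : Q ≠ 0 := by intro h; simp [h] at hp
  have h1 : ((-1:ℝ) ^ i)⁻¹ = (-1) ^ i := by
    rw [← inv_pow]; norm_num
  rw [div_eq_mul_inv, mul_inv, h1]; ring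

open Polynomial in
theorem hcp_pt {K : Set ℂ} (hK : IsPreconnected K) {a b : ℂ} (ha : a ∈ K) (hb : b ∈ K)
    {s : ℝ} (hs : 0 < s) (hab : s ≤ dist b a) {θ : ℝ} (hθ : 0 ≤ θ) {n : ℕ} {e : ℂ[X]}
    (he : e.degree ≤ n) {M : ℝ} (hM : ∀ z ∈ K, ‖e.eval z‖ ≤ M) {z : ℂ}
    (hz : dist z a ≤ s * (Real.cosh θ - 1) / 2) : ‖e.eval z‖ ≤ M * Real.exp θ ^ n := by
  have hM0 : 0 ≤ M := (norm_nonneg _).trans (hM a ha)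
  have hx : ∀ i : ℕ, ∃ w ∈ K, dist w a = s * (1 - Chebyshev.node n i) / 2 := by
    intro i
    have h1 := hK.intermediate_value ha hb (f := fun w => dist w a) (by fun_prop)
    have h2 := Chebyshev.node_mem_Icc (n := n) (i := i)
    obtain ⟨w, hw, h⟩ := h1 (show s * (1 - Chebyshev.node n i) / 2 ∈ Set.Icc _ _ from
      ⟨by simp; nlinarith [h2.2], by nlinarith [h2.1]⟩)
    exact ⟨w, hw, h⟩
  choose w hwK hw using hx
  have hd : ∀ i j, s / 2 * |Chebyshev.node n i - Chebyshev.node n j| ≤ ‖w i - w j‖ := by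
    intro i j
    have := abs_dist_sub_le (w i) (w j) a
    rw [hw, hw, dist_eq_norm] at this
    refine le_trans (le_of_eq ?_) this
    rw [← abs_of_pos (half_pos hs), ← abs_mul, ← abs_neg]
    congr 1; ring
  have hninj : Set.InjOn (Chebyshev.node n) (Finset.range (n+1) : Finset ℕ) :=
    (Chebyshev.strictAntiOn_node n).injOn
  have hpos : ∀ i ∈ Finset.range (n+1), ∀ j ∈ Finset.range (n+1), i ≠ j →
      0 < |Chebyshev.node n i - Chebyshev.node n j| := by
    intro i hi j hj hij
    exact abs_pos.2 (sub_ne_zero.2 (fun h => hij (hninj hi hj h)))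
  have hinj : Set.InjOn w (Finset.range (n+1) : Finset ℕ) := by
    intro i hi j hj h
    by_contra hij
    have := hd i j
    rw [h] at this; simp at this
    have h2 := hpos i hi j hj hij
    nlinarith
  have hT := Lagrange.eq_interpolate (f := e) hinj (by
    rw [Finset.card_range]; refine lt_of_le_of_lt he ?_; norm_cast; omega)
  rw [hT, Lagrange.interpolate_apply, eval_finsetSum]
  refine (norm_sum_le _ _).trans ?_
  refine le_trans ?_ (mul_le_mul_of_nonneg_left (cheb_sum n θ hθ) hM0)
  rw [Finset.mul_sum]
  refine Finset.sum_le_sum fun i hi => ?_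
  rw [eval_mul, eval_C, norm_mul]
  refine mul_le_mul (hM _ (hwK i)) ?_ (norm_nonneg _) hM0
  rw [Lagrange.basis, eval_prod, norm_prod]
  refine Finset.prod_le_prod (fun _ _ => norm_nonneg _) fun j hj => ?_
  simp only [Lagrange.basisDivisor, eval_mul, eval_C, eval_sub, eval_X, norm_mul, norm_inv]
  have hj' := Finset.mem_erase.1 hj
  have hp := hpos i hi j hj'.2 hj'.1.symm
  have h1 : ‖z - w j‖ ≤ s / 2 * (Real.cosh θ - Chebyshev.node n j) := by
    rw [← dist_eq_norm]
    refine (dist_triangle_right z (w j) a).trans ?_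
    rw [hw]; linarith
  have h2 := hd i j
  rw [mul_comm, ← div_eq_mul_inv]
  have h3 : 0 < s / 2 * |Chebyshev.node n i - Chebyshev.node n j| := by positivity
  calc _ ≤ (s / 2 * (Real.cosh θ - Chebyshev.node n j)) / (s / 2 * |Chebyshev.node n i - Chebyshev.node n j|) := by
        gcongr
        exact (norm_nonneg _).trans h1
    _ = _ := by field_simp


noncomputable def dbar (φ : ℂ → ℂ) (z : ℂ) : ℂ :=
  (fderiv ℝ φ z 1 + Complex.I * fderiv ℝ φ z Complex.I) / 2

open MeasureTheory Real in
theorem pompeiu_zero {φ : ℂ → ℂ} (hφ : ContDiff ℝ 1 φ) (hc : HasCompactSupport φ) :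
    ∫ ζ, dbar φ ζ * ζ⁻¹ = -(π * φ 0) := by
  have hD : Continuous (fderiv ℝ φ) := hφ.continuous_fderiv one_ne_zero
  have hdiff : Differentiable ℝ φ := hφ.differentiable one_ne_zero
  obtain ⟨R, hR0, hR⟩ : ∃ R : ℝ, 0 < R ∧ ∀ z : ℂ, R < ‖z‖ → fderiv ℝ φ z = 0 ∧ φ z = 0 := by
    obtain ⟨R, hR⟩ := hc.isBounded.subset_closedBall 0
    refine ⟨max R 1, by positivity, fun z hz => ?_⟩
    have h1 : z ∉ tsupport φ := fun h => by
      have := hR h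
      simp at this
      have := le_max_left R 1
      linarith
    exact ⟨by
      by_contra h
      exact h1 (support_fderiv_subset ℝ h), image_eq_zero_of_notMem_tsupport h1⟩
  let c : ℝ × ℝ → ℂ := fun p => p.1 * Complex.exp (p.2 * Complex.I)
  have hcc : Continuous c := by fun_prop
  have hcn : ∀ p, ‖c p‖ = |p.1| := by intro p; simp [c, Complex.norm_exp_ofReal_mul_I]
  let g1 : ℝ × ℝ → ℂ := fun p => fderiv ℝ φ (c p) (Complex.exp (p.2 * Complex.I))
  let g2 : ℝ × ℝ → ℂ := fun p => fderiv ℝ φ (c p) (Complex.I * Complex.exp (p.2 * Complex.I))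
  have hg1 : Continuous g1 := by
    exact (hD.comp hcc).clm_apply (by fun_prop)
  have hg2 : Continuous g2 := by
    exact (hD.comp hcc).clm_apply (by fun_prop)
  have hIntg : ∀ g : ℝ × ℝ → ℂ, Continuous g → (∀ p, R < |p.1| → g p = 0) →
      IntegrableOn g (Set.Ioi 0 ×ˢ Set.Ioo (-π) π) := by
    intro g hg hz
    have h1 : IntegrableOn g (Set.Icc 0 R ×ˢ Set.Icc (-π) π) :=
      hg.continuousOn.integrableOn_compact (isCompact_Icc.prod isCompact_Icc)
    refine h1.of_forall_sdiff_eq_zero (measurableSet_Ioi.prod measurableSet_Ioo) ?_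
    rintro ⟨r, t⟩ ⟨⟨h1, h2⟩, h3⟩
    simp only [Set.mem_Ioi, Set.mem_Ioo, Set.mem_prod, Set.mem_Icc, not_and_or, not_le] at h1 h2 h3
    apply hz
    rw [abs_of_pos h1]
    rcases h3 with (h3 | h3) | (h3 | h3) <;> linarith [h2.1, h2.2]
  have hi1 := hIntg g1 hg1 (fun p hp => by
    simp only [g1]; rw [(hR (c p) (by rwa [hcn])).1]; rfl)
  have hi2 := hIntg g2 hg2 (fun p hp => by
    simp only [g2]; rw [(hR (c p) (by rwa [hcn])).1]; rfl)
  rw [← Complex.integral_comp_polarCoord_symm]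
  have hEq : ∀ p ∈ polarCoord.target, p.1 • (dbar φ (Complex.polarCoord.symm p) * (Complex.polarCoord.symm p)⁻¹)
      = (1/2 : ℂ) * (g1 p + Complex.I * g2 p) := by
    rintro ⟨r, t⟩ hp
    have hr : 0 < r := hp.1
    have h1 : Complex.polarCoord.symm (r, t) = c (r, t) := by
      simp [Complex.polarCoord_symm_apply, c, Complex.exp_mul_I]
    rw [h1]
    have h2 : g1 (r, t) = cos t * fderiv ℝ φ (c (r,t)) 1 + sin t * fderiv ℝ φ (c (r,t)) Complex.I := by
      have : Complex.exp (t * Complex.I) = cos t • (1:ℂ) + sin t • Complex.I := by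
        rw [Complex.exp_mul_I]; simp
      simp only [g1]
      rw [this, map_add, map_smul, map_smul]; simp
    have h3 : g2 (r, t) = cos t * fderiv ℝ φ (c (r,t)) Complex.I - sin t * fderiv ℝ φ (c (r,t)) 1 := by
      have : Complex.I * Complex.exp (t * Complex.I) = cos t • Complex.I - sin t • (1:ℂ) := by
        rw [Complex.exp_mul_I]; simp
        linear_combination (Complex.sin t) * Complex.I_sq
      simp only [g2]
      rw [this, map_sub, map_smul, map_smul]; simp
    have hinv : (c (r,t))⁻¹ = (r:ℂ)⁻¹ * (cos t - sin t * Complex.I) := by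
      simp only [c]
      rw [mul_inv, ← Complex.exp_neg, ← neg_mul, ← Complex.ofReal_neg, Complex.exp_mul_I]
      simp [sub_eq_add_neg]
    rw [h2, h3, hinv, dbar]
    have hr' : (r:ℂ) ≠ 0 := by exact_mod_cast hr.ne'
    simp only [Complex.real_smul]
    field_simp
    linear_combination (- (sin t : ℂ) * fderiv ℝ φ (c (r,t)) Complex.I) * Complex.I_sq
  rw [setIntegral_congr_fun (by exact measurableSet_Ioi.prod measurableSet_Ioo) hEq]
  have htgt : polarCoord.target = Set.Ioi 0 ×ˢ Set.Ioo (-π) π := rfl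
  rw [htgt, integral_const_mul, integral_add hi1 (hi2.const_mul _), integral_const_mul]
  have e2 : ∫ p in Set.Ioi 0 ×ˢ Set.Ioo (-π) π, g2 p = 0 := by
    rw [Measure.volume_eq_prod] at hi2 ⊢
    rw [setIntegral_prod _ hi2]
    refine setIntegral_eq_zero_of_forall_eq_zero ?_
    intro r hr
    have hr' : (r:ℂ) ≠ 0 := by exact_mod_cast (ne_of_gt hr)
    rw [← integral_Ioc_eq_integral_Ioo, ← intervalIntegral.integral_of_le (by linarith [pi_pos])]
    have hder : ∀ t ∈ Set.uIcc (-π) π, HasDerivAt (fun t : ℝ => (r:ℂ)⁻¹ * φ (c (r, t))) (g2 (r,t)) t := by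
      intro t _
      have h1 : HasDerivAt (fun t : ℝ => c (r, t)) (r * (Complex.exp (t * Complex.I) * Complex.I)) t := by
        have : HasDerivAt (fun t : ℝ => (t:ℂ) * Complex.I) (Complex.I) t := by
          simpa using (Complex.ofRealCLM.hasDerivAt (x := t)).mul_const Complex.I
        exact this.cexp.const_mul (r:ℂ)
      have h2 := ((hdiff (c (r,t))).hasFDerivAt.comp_hasDerivAt t h1).const_mul (r:ℂ)⁻¹
      convert! h2 using 1
      have : (r * (Complex.exp (t * Complex.I) * Complex.I) : ℂ) = r • (Complex.I * Complex.exp (t * Complex.I)) := by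
        rw [Complex.real_smul]; ring
      rw [this, map_smul]
      simp only [g2, Complex.real_smul]
      field_simp
    rw [intervalIntegral.integral_eq_sub_of_hasDerivAt hder
      ((hg2.comp (by fun_prop : Continuous fun t : ℝ => (r,t))).intervalIntegrable _ _)]
    have : c (r, π) = c (r, -π) := by
      simp [c, Complex.exp_mul_I]
    rw [this, sub_self]
  have e1 : ∫ p in Set.Ioi 0 ×ˢ Set.Ioo (-π) π, g1 p = -(2 * π * φ 0) := by
    rw [Measure.volume_eq_prod] at hi1 ⊢
    rw [IntegrableOn, ← Measure.prod_restrict] at hi1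
    rw [← Measure.prod_restrict]
    rw [← integral_prod_swap]
    rw [integral_prod _ (by exact Integrable.swap hi1)]
    have : ∀ t : ℝ, ∫ r in Set.Ioi 0, g1 (r, t) = - φ 0 := by
      intro t
      have hder : ∀ r ∈ Set.Ici (0:ℝ), HasDerivAt (fun r : ℝ => φ (c (r, t))) (g1 (r,t)) r := by
        intro r _
        have h1 : HasDerivAt (fun r : ℝ => c (r, t)) (Complex.exp (t * Complex.I)) r := by
          simpa [c] using (Complex.ofRealCLM.hasDerivAt (x := r)).mul_const (Complex.exp (t * Complex.I))
        exact (hdiff (c (r,t))).hasFDerivAt.comp_hasDerivAt r h1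
      have hz : ∀ r : ℝ, R < r → g1 (r,t) = 0 ∧ φ (c (r,t)) = 0 := by
        intro r hr
        have : R < ‖c (r,t)‖ := by rw [hcn]; exact hr.trans_le (le_abs_self _)
        exact ⟨by simp only [g1]; rw [(hR _ this).1]; rfl, (hR _ this).2⟩
      have hcont : Continuous fun r : ℝ => g1 (r,t) := hg1.comp (by fun_prop)
      rw [integral_Ioi_of_hasDerivAt_of_tendsto' hder (m := 0)]
      · simp [c]
      · refine (hcont.continuousOn.integrableOn_compact (isCompact_Icc (a := (0:ℝ)) (b := R))).of_forall_sdiff_eq_zero measurableSet_Ioi ?_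
        rintro r ⟨h1, h2⟩
        apply (hz r _).1
        by_contra h
        exact h2 ⟨le_of_lt h1, not_lt.1 h⟩
      · refine tendsto_const_nhds.congr' ?_
        filter_upwards [eventually_gt_atTop R] with r hr using ((hz r hr).2).symm
    simp only [Prod.swap, this]
    simp
    rw [max_eq_left (by linarith [pi_pos])]
    left; push_cast; ring
  rw [e1, e2]; ring

open MeasureTheory in
theorem pompeiu {φ : ℂ → ℂ} (hφ : ContDiff ℝ 1 φ) (hc : HasCompactSupport φ) (z : ℂ) :
    ∫ ζ, dbar φ ζ * (ζ - z)⁻¹ = -(Real.pi * φ z) := by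
  have h := pompeiu_zero (φ := fun ζ => φ (ζ + z)) (by fun_prop)
    (hc.comp_homeomorph (Homeomorph.addRight z))
  rw [zero_add] at h
  rw [← h, ← integral_add_right_eq_self _ z]
  congr 1; ext ζ
  simp [dbar, fderiv_comp_add_right]


/-- uniform approximability by polynomials on `K` -/
def PA (K : Set ℂ) (f : ℂ → ℂ) : Prop :=
  ∀ ε : ℝ, 0 < ε → ∃ p : Polynomial ℂ, ∀ z ∈ K, ‖f z - p.eval z‖ ≤ ε

theorem PA.bdd {K : Set ℂ} (hK : IsCompact K) {f : ℂ → ℂ} (hf : PA K f) :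
    ∃ M : ℝ, 0 < M ∧ ∀ z ∈ K, ‖f z‖ ≤ M := by
  obtain ⟨p, hp⟩ := hf 1 one_pos
  obtain ⟨M, hM⟩ := hK.exists_bound_of_continuousOn (f := fun z => p.eval z) (by fun_prop)
  refine ⟨max M 0 + 1, by positivity, fun z hz => ?_⟩
  have h1 := hp z hz
  have h2 := hM z hz
  calc ‖f z‖ = ‖p.eval z + (f z - p.eval z)‖ := by congr 1; ring
    _ ≤ M + 1 := (norm_add_le _ _).trans (add_le_add h2 h1)
    _ ≤ _ := by gcongr; exact le_max_left _ _

theorem PA.poly (K : Set ℂ) (p : Polynomial ℂ) : PA K (fun z => p.eval z) :=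
  fun ε hε => ⟨p, fun z _ => by simpa using hε.le⟩

theorem PA.const (K : Set ℂ) (c : ℂ) : PA K (fun _ => c) := by
  simpa using PA.poly K (Polynomial.C c)

theorem PA.id (K : Set ℂ) : PA K (fun z => z) := by
  simpa using PA.poly K Polynomial.X

theorem PA.congr {K : Set ℂ} {f g : ℂ → ℂ} (hf : PA K f) (h : ∀ z ∈ K, f z = g z) : PA K g := by
  intro ε hε
  obtain ⟨p, hp⟩ := hf ε hε
  exact ⟨p, fun z hz => by rw [← h z hz]; exact hp z hz⟩

theorem PA.add {K : Set ℂ} {f g : ℂ → ℂ} (hf : PA K f) (hg : PA K g) :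
    PA K (fun z => f z + g z) := by
  intro ε hε
  obtain ⟨p, hp⟩ := hf (ε/2) (by positivity)
  obtain ⟨q, hq⟩ := hg (ε/2) (by positivity)
  refine ⟨p + q, fun z hz => ?_⟩
  rw [Polynomial.eval_add]
  calc _ = ‖(f z - p.eval z) + (g z - q.eval z)‖ := by congr 1; ring
    _ ≤ ε/2 + ε/2 := (norm_add_le _ _).trans (add_le_add (hp z hz) (hq z hz))
    _ = ε := by ring

theorem PA.limit {K : Set ℂ} {f : ℂ → ℂ} (h : ∀ ε : ℝ, 0 < ε → ∃ g, PA K g ∧ ∀ z ∈ K, ‖f z - g z‖ ≤ ε) :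
    PA K f := by
  intro ε hε
  obtain ⟨g, hg, hfg⟩ := h (ε/2) (by positivity)
  obtain ⟨q, hq⟩ := hg (ε/2) (by positivity)
  refine ⟨q, fun z hz => ?_⟩
  calc _ = ‖(f z - g z) + (g z - q.eval z)‖ := by congr 1; ring
    _ ≤ ε/2 + ε/2 := (norm_add_le _ _).trans (add_le_add (hfg z hz) (hq z hz))
    _ = ε := by ring

theorem PA.mul {K : Set ℂ} (hK : IsCompact K) {f g : ℂ → ℂ} (hf : PA K f) (hg : PA K g) :
    PA K (fun z => f z * g z) := by
  intro ε hε
  obtain ⟨M, hM0, hM⟩ := hg.bdd hK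
  obtain ⟨p, hp⟩ := hf (ε/2/M) (by positivity)
  obtain ⟨N, hN0, hN⟩ := (PA.poly K p).bdd hK
  obtain ⟨q, hq⟩ := hg (ε/2/N) (by positivity)
  refine ⟨p * q, fun z hz => ?_⟩
  rw [Polynomial.eval_mul]
  calc _ = ‖(f z - p.eval z) * g z + p.eval z * (g z - q.eval z)‖ := by congr 1; ring
    _ ≤ (ε/2/M) * M + N * (ε/2/N) := by
      refine (norm_add_le _ _).trans ?_
      rw [norm_mul, norm_mul]
      gcongr
      · exact hp z hz
      · exact hM z hz
      · exact hN z hz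
      · exact hq z hz
    _ = ε := by field_simp; ring

theorem PA.neg {K : Set ℂ} {f : ℂ → ℂ} (hf : PA K f) : PA K (fun z => - f z) := by
  intro ε hε
  obtain ⟨p, hp⟩ := hf ε hε
  refine ⟨-p, fun z hz => ?_⟩
  rw [Polynomial.eval_neg, ← neg_sub', norm_neg]; exact hp z hz

theorem PA.sub {K : Set ℂ} {f g : ℂ → ℂ} (hf : PA K f) (hg : PA K g) :
    PA K (fun z => f z - g z) := by
  simpa [sub_eq_add_neg] using hf.add hg.neg

theorem PA.polycomp {K : Set ℂ} (hK : IsCompact K) {f : ℂ → ℂ} (hf : PA K f) (Q : Polynomial ℂ) :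
    PA K (fun z => Q.eval (f z)) := by
  induction Q using Polynomial.induction_on' with
  | add p q hp hq => simpa using hp.add hq
  | monomial n a =>
    have : PA K (fun z => f z ^ n) := by
      induction n with
      | zero => simpa using PA.const K 1
      | succ n ih => simpa [pow_succ] using ih.mul hK hf
    simpa using (PA.const K a).mul hK this

theorem PA.comp {K : Set ℂ} (hK : IsCompact K) {f φ : ℂ → ℂ} (hf : PA K f) {r R : ℝ} (hr : 0 ≤ r) (hrR : r < R)
    (hφ : DifferentiableOn ℂ φ (ball 0 R)) (hb : ∀ z ∈ K, ‖f z‖ ≤ r) : PA K (fun z => φ (f z)) := by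
  obtain ⟨r1, h1, h2⟩ := exists_between hrR
  obtain ⟨r2, h3, h4⟩ := exists_between h2
  have hr2 : 0 < r2 := by linarith
  lift r2 to NNReal using hr2.le
  have hps := (hφ.mono (closedBall_subset_ball h4)).hasFPowerSeriesOnBall (by exact_mod_cast hr2)
  lift r1 to NNReal using (by linarith)
  have hu := hps.tendstoUniformlyOn (r' := r1) (by exact_mod_cast h3)
  refine PA.limit fun ε hε => ?_
  rw [Metric.tendstoUniformlyOn_iff] at hu
  obtain ⟨N, hN⟩ := (hu ε hε).exists
  refine ⟨_, hf.polycomp hK (∑ k ∈ Finset.range N, Polynomial.monomial k ((cauchyPowerSeries φ 0 r2).coeff k)), fun z hz => ?_⟩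
  have := hN (f z) (by simpa using (hb z hz).trans_lt h1)
  rw [dist_eq_norm] at this
  convert! this.le using 2
  simp [FormalMultilinearSeries.partialSum, Polynomial.eval_finsetSum, mul_comm]

theorem PA_inv_step {K : Set ℂ} (hK : IsCompact K) {w w' : ℂ} {ρ : ℝ} (hρ : ∀ z ∈ K, ρ ≤ ‖z - w‖)
    (hw' : ‖w' - w‖ < ρ) (hw : PA K (fun z => (z - w)⁻¹)) : PA K (fun z => (z - w')⁻¹) := by
  have hρ0 : 0 < ρ := (norm_nonneg _).trans_lt hw'
  have h1 : PA K (fun z => (w' - w) * (z - w)⁻¹) := (PA.const K _).mul hK hw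
  have h2 := h1.comp hK (φ := fun t => (1 - t)⁻¹) (r := ‖w' - w‖ / ρ) (R := 1) (by positivity)
    (by rw [div_lt_one hρ0]; exact hw') (by
      intro t ht
      have : (1:ℂ) - t ≠ 0 := by
        intro h
        have : t = 1 := by linear_combination -h
        simp [this] at ht
      fun_prop (disch := assumption)) (by
      intro z hz
      rw [norm_mul, norm_inv, div_eq_mul_inv]
      gcongr
      exact hρ z hz)
  refine (hw.mul hK h2).congr fun z hz => ?_
  have hz1 : z - w ≠ 0 := by
    rw [← norm_pos_iff]; exact hρ0.trans_le (hρ z hz)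
  rw [← mul_inv]
  congr 1
  field_simp; ring

theorem PA_inv {K : Set ℂ} (hK : IsCompact K) (hc : IsConnected Kᶜ) {w : ℂ} (hw : w ∉ K) :
    PA K (fun z => (z - w)⁻¹) := by
  let V : Set ℂ := {w | w ∉ K ∧ PA K (fun z => (z - w)⁻¹)}
  have hsep : ∀ x ∉ K, ∃ ρ > 0, ∀ z ∈ K, 2 * ρ ≤ ‖z - x‖ := by
    intro x hx
    obtain ⟨ρ, h0, h⟩ := Metric.isOpen_iff.1 hK.isClosed.isOpen_compl x hx
    refine ⟨ρ/2, by positivity, fun z hz => ?_⟩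
    by_contra h2
    exact h (show z ∈ ball x ρ by rw [mem_ball, dist_eq_norm]; linarith) hz
  have hstep : ∀ x ∉ K, ∃ ρ > 0, ∀ y, ‖y - x‖ < ρ → y ∉ K ∧ (PA K (fun z => (z - x)⁻¹) ↔ PA K (fun z => (z - y)⁻¹)) := by
    intro x hx
    obtain ⟨ρ, h0, h⟩ := hsep x hx
    refine ⟨ρ, h0, fun y hy => ⟨fun hyK => by have := h y hyK; linarith, fun h1 => ?_, fun h1 => ?_⟩⟩
    · exact PA_inv_step hK h (by linarith) h1
    · refine PA_inv_step hK (w := y) (ρ := ρ) (fun z hz => ?_) (by rwa [norm_sub_rev]) h1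
      have h3 := h z hz
      have : ‖z - x‖ ≤ ‖z - y‖ + ‖y - x‖ := norm_sub_le_norm_sub_add_norm_sub z y x
      linarith
  have hVo : IsOpen V := by
    rw [Metric.isOpen_iff]
    rintro x ⟨hx, hx2⟩
    obtain ⟨ρ, h0, h⟩ := hstep x hx
    refine ⟨ρ, h0, fun y hy => ?_⟩
    rw [mem_ball, dist_eq_norm] at hy
    exact ⟨(h y hy).1, (h y hy).2.1 hx2⟩
  have hVc : closure V ∩ Kᶜ ⊆ V := by
    rintro x ⟨hx, hxK⟩
    obtain ⟨ρ, h0, h⟩ := hstep x hxK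
    obtain ⟨y, hy, hxy⟩ := Metric.mem_closure_iff.1 hx ρ h0
    rw [dist_comm, dist_eq_norm] at hxy
    exact ⟨hxK, (h y hxy).2.2 hy.2⟩
  obtain ⟨M, hM⟩ := hK.isBounded.exists_norm_le
  have hne : (Kᶜ ∩ V).Nonempty := by
    let x : ℂ := ((2 * |M| + 1 : ℝ) : ℂ)
    have hxn : ‖x‖ = 2 * |M| + 1 := by
      simp only [x]; rw [Complex.norm_real, Real.norm_of_nonneg (by positivity)]
    have hx0 : x ≠ 0 := by rw [← norm_pos_iff, hxn]; positivity
    have hxK : x ∉ K := fun h => by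
      have := hM x h
      rw [hxn] at this
      linarith [le_abs_self M, abs_nonneg M]
    refine ⟨x, hxK, hxK, ?_⟩
    have h2 := ((PA.const K x⁻¹).mul hK (PA.id K)).comp hK (φ := fun t => (1 - t)⁻¹) (r := 1/2) (R := 1) (by positivity)
      (by norm_num) (by
      intro t ht
      have : (1:ℂ) - t ≠ 0 := by
        intro h
        have : t = 1 := by linear_combination -h
        simp [this] at ht
      fun_prop (disch := assumption)) (by
      intro z hz
      rw [norm_mul, norm_inv, hxn, inv_mul_le_iff₀ (by positivity)]
      linarith [hM z hz, le_abs_self M])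
    refine ((PA.const K (-x⁻¹)).mul hK h2).congr fun z hz => ?_
    rw [← inv_neg, ← mul_inv]
    congr 1
    field_simp; ring
  exact (hc.isPreconnected.subset_of_closure_inter_subset hVo hne hVc hw).2


theorem one_sub_re_pos {α : ℂ} (h : ‖α‖ < 1) : 0 < (1 - α).re := by
  have := (Complex.abs_re_le_norm α).trans_lt h
  have := (abs_lt.1 this).2
  simp; linarith

theorem arg_bd {x : ℂ} (h : 0 < x.re) : |(Complex.log x).im| < Real.pi / 2 := by
  rw [Complex.log_im]
  exact Complex.abs_arg_lt_pi_div_two_iff.2 (Or.inl h)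

theorem log_step {α α' : ℂ} (h : ‖α‖ < 1) (h' : ‖α'‖ < 1) :
    Complex.log (1 - α) + Complex.log ((1 - α') / (1 - α)) = Complex.log (1 - α') := by
  have h1 := one_sub_re_pos h
  have h2 := one_sub_re_pos h'
  have n1 : 1 - α ≠ 0 := fun h => by simp [h] at h1
  have n2 : 1 - α' ≠ 0 := fun h => by simp [h] at h2
  have a1 := abs_lt.1 (arg_bd h1)
  have a2 := abs_lt.1 (arg_bd h2)
  have : (1 - α') / (1 - α) = Complex.exp (Complex.log (1 - α') - Complex.log (1 - α)) := by
    rw [Complex.exp_sub, Complex.exp_log n1, Complex.exp_log n2]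
  rw [this, Complex.log_exp]
  · ring
  · simp only [Complex.sub_im]; linarith
  · simp only [Complex.sub_im]; linarith

/-- the chain predicate -/
def Ch (K : Set ℂ) (p a : ℂ) : Prop :=
  ∃ l : ℂ → ℂ, PA K l ∧ ∀ z ∈ K, Complex.exp (l z) = (z - a) / (z - p) ∧
    (2 ≤ ‖z - p‖ → l z = Complex.log (1 - (a - p) / (z - p)))

theorem Ch_step {K : Set ℂ} (hK : IsCompact K) (hc : IsConnected Kᶜ) {p a a' : ℂ} {ρ : ℝ}
    (hp : p ∉ K) (haK : a ∉ K) (ha : ‖a - p‖ < 2) (ha' : ‖a' - p‖ < 2) (hρ : ∀ z ∈ K, ρ ≤ ‖z - a‖)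
    (hd : ‖a' - a‖ < ρ) (h : Ch K p a) : Ch K p a' := by
  obtain ⟨l, hl, hl2⟩ := h
  have hρ0 : 0 < ρ := (norm_nonneg _).trans_lt hd
  have h1 : PA K (fun z => (a' - a) * (z - a)⁻¹) := (PA.const K _).mul hK (PA_inv hK hc haK)
  have hb : ∀ z ∈ K, ‖(a' - a) * (z - a)⁻¹‖ ≤ ‖a' - a‖ / ρ := by
    intro z hz
    rw [norm_mul, norm_inv, div_eq_mul_inv]
    gcongr
    exact hρ z hz
  have hlt : ‖a' - a‖ / ρ < 1 := by rw [div_lt_one hρ0]; exact hd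
  have h2 := h1.comp hK (φ := fun t => Complex.log (1 - t)) (r := ‖a' - a‖ / ρ) (R := 1) (by positivity)
    hlt (by
      intro t ht
      have : 0 < (1 - t).re := one_sub_re_pos (by simpa using ht)
      exact ((differentiableAt_const _).sub differentiableAt_id).clog (Or.inl this) |>.differentiableWithinAt) hb
  refine ⟨_, hl.add h2, fun z hz => ?_⟩
  have hza : z - a ≠ 0 := by rw [← norm_pos_iff]; exact hρ0.trans_le (hρ z hz)
  have hzp : z - p ≠ 0 := sub_ne_zero.2 (fun h => hp (h ▸ hz))
  have e1 : 1 - (a' - a) * (z - a)⁻¹ = (z - a') / (z - a) := by field_simp; ring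
  have hn : 1 - (a' - a) * (z - a)⁻¹ ≠ 0 := by
    intro h
    have := one_sub_re_pos ((hb z hz).trans_lt hlt)
    simp [h] at this
  refine ⟨?_, fun hz2 => ?_⟩
  · rw [Complex.exp_add, (hl2 z hz).1, Complex.exp_log hn, e1]; field_simp
  · rw [(hl2 z hz).2 hz2, e1, ← log_step (α := (a - p) / (z - p)) (α' := (a' - p) / (z - p))]
    · congr 2
      have : 1 - (a - p) / (z - p) = (z - a) / (z - p) := by field_simp; ring
      rw [this]
      field_simp; ring
    · rw [norm_div, div_lt_one (by positivity)]; linarith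
    · rw [norm_div, div_lt_one (by positivity)]; linarith

theorem exists_Ch {K : Set ℂ} (hK : IsCompact K) (hc : IsConnected Kᶜ) {p : ℂ} (hp : p ∉ K) :
    ∃ a, 1 ≤ ‖a - p‖ ∧ ‖a - p‖ < 2 ∧ Ch K p a := by
  by_contra hcon
  push Not at hcon
  let V : Set ℂ := {a | a ∉ K ∧ ‖a - p‖ < 2 ∧ Ch K p a}
  have hsep : ∀ x ∉ K, ∃ ρ > 0, ∀ z ∈ K, 2 * ρ ≤ ‖z - x‖ := by
    intro x hx
    obtain ⟨ρ, h0, h⟩ := Metric.isOpen_iff.1 hK.isClosed.isOpen_compl x hx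
    refine ⟨ρ/2, by positivity, fun z hz => ?_⟩
    by_contra h2
    exact h (show z ∈ ball x ρ by rw [mem_ball, dist_eq_norm]; linarith) hz
  have hstep : ∀ x ∉ K, ‖x - p‖ < 2 → ∃ ρ > 0, ∀ y, ‖y - x‖ < ρ → y ∉ K ∧ ‖y - p‖ < 2 ∧ (Ch K p x ↔ Ch K p y) := by
    intro x hx hx2
    obtain ⟨ρ, h0, h⟩ := hsep x hx
    refine ⟨min ρ (2 - ‖x - p‖), lt_min h0 (by linarith), fun y hy => ?_⟩
    have hy1 := hy.trans_le (min_le_left _ _)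
    have hy2 := hy.trans_le (min_le_right _ _)
    have hyp : ‖y - p‖ < 2 := by
      have := norm_sub_le_norm_sub_add_norm_sub y x p
      linarith
    have hyK : y ∉ K := fun hyK => by have := h y hyK; linarith
    refine ⟨hyK, hyp, fun h1 => ?_, fun h1 => ?_⟩
    · exact Ch_step hK hc hp hx hx2 hyp h (by linarith) h1
    · refine Ch_step hK hc hp hyK hyp hx2 (ρ := ρ) (fun z hz => ?_) (by rwa [norm_sub_rev]) h1
      have h3 := h z hz
      have : ‖z - x‖ ≤ ‖z - y‖ + ‖y - x‖ := norm_sub_le_norm_sub_add_norm_sub z y x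
      linarith
  have hVo : IsOpen V := by
    rw [Metric.isOpen_iff]
    rintro x ⟨hx, hx2, hx3⟩
    obtain ⟨ρ, h0, h⟩ := hstep x hx hx2
    refine ⟨ρ, h0, fun y hy => ?_⟩
    rw [mem_ball, dist_eq_norm] at hy
    exact ⟨(h y hy).1, (h y hy).2.1, (h y hy).2.2.1 hx3⟩
  have hV1 : V ⊆ closedBall p 1 := by
    rintro x ⟨hx, hx2, hx3⟩
    rw [mem_closedBall, dist_eq_norm]
    by_contra h
    exact hcon x (not_le.1 h).le hx2 hx3
  have hVc : closure V ∩ Kᶜ ⊆ V := by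
    rintro x ⟨hx, hxK⟩
    have hx1 := closure_minimal hV1 isClosed_closedBall hx
    rw [mem_closedBall, dist_eq_norm] at hx1
    obtain ⟨ρ, h0, h⟩ := hstep x hxK (by linarith)
    obtain ⟨y, hy, hxy⟩ := Metric.mem_closure_iff.1 hx ρ h0
    rw [dist_comm, dist_eq_norm] at hxy
    exact ⟨hxK, by linarith, (h y hxy).2.2.2 hy.2.2⟩
  have hpV : p ∈ V := ⟨hp, by simp, fun _ => 0, PA.const K 0, fun z hz => by
    have hzp : z - p ≠ 0 := sub_ne_zero.2 (fun h => hp (h ▸ hz))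
    simp [hzp]⟩
  have hsub := hc.isPreconnected.subset_of_closure_inter_subset hVo ⟨p, hp, hpV⟩ hVc
  have hb : Bornology.IsBounded (Kᶜ) := (isBounded_closedBall.subset hV1).subset hsub
  have := hb.union hK.isBounded
  rw [Set.compl_union_self] at this
  exact NormedSpace.unbounded_univ ℂ ℂ this

theorem exists_g {K : Set ℂ} (hK : IsCompact K) (hc : IsConnected Kᶜ) {p : ℂ} (hp : p ∉ K) :
    ∃ (c : ℂ) (g : ℂ → ℂ), PA K g ∧ 1/2 ≤ ‖c‖ ∧ ‖c‖ < 1 ∧ ∀ z ∈ K,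
      (z - (p + c)) * g z = 1 + c^2 / 4 * (g z)^2 ∧
      ‖g z‖ ≤ 2 * (2 * ‖z - (p + c)‖ + ‖c‖) / ‖c‖^2 ∧
      (2 ≤ ‖z - p‖ → ‖g z‖ ≤ 4 / ‖z - p‖) := by
  obtain ⟨a, ha1, ha2, l, hl, hl2⟩ := exists_Ch hK hc hp
  obtain ⟨M, hM0, hM⟩ := hl.bdd hK
  have hexp : PA K (fun z => Complex.exp (l z / 2)) := by
    refine hl.comp hK (φ := fun t => Complex.exp (t / 2)) (R := M + 1) hM0.le (by linarith) ?_ hM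
    exact Differentiable.differentiableOn (by fun_prop)
  obtain ⟨c, hcdef⟩ : ∃ c : ℂ, a = p + 2 * c := ⟨(a - p)/2, by ring⟩
  have hcn : ‖a - p‖ = 2 * ‖c‖ := by rw [hcdef]; simp
  have hc0 : c ≠ 0 := by rw [← norm_pos_iff]; linarith
  refine ⟨c, fun z => (2 / c^2) * ((z - (p + c)) - (z - p) * Complex.exp (l z / 2)), ?_, by linarith, by linarith, fun z hz => ?_⟩
  · exact (PA.const K _).mul hK (((PA.id K).sub (PA.const K _)).sub
      (((PA.id K).sub (PA.const K _)).mul hK hexp))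
  · have hzp : z - p ≠ 0 := sub_ne_zero.2 (fun h => hp (h ▸ hz))
    set κ := Complex.exp (l z / 2) with hκ
    have hκ2 : κ ^ 2 = (z - a) / (z - p) := by
      rw [hκ, ← Complex.exp_nat_mul, ← (hl2 z hz).1]; congr 1; push_cast; ring
    have hκ3 : (z - p) * κ ^ 2 = z - p - 2 * c := by
      rw [hκ2, hcdef]; field_simp; ring
    have hs : ((z - p) * κ)^2 = (z - (p + c))^2 - c^2 := by
      linear_combination (z - p) * hκ3
    refine ⟨?_, ?_, fun hz2 => ?_⟩
    · field_simp
      linear_combination -4 * hs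
    · rw [norm_mul, norm_div, norm_pow]
      have h2 : ‖(2:ℂ)‖ = 2 := by simp
      rw [h2, div_mul_eq_mul_div]
      gcongr
      have h3 : ‖(z - p) * κ‖ ≤ ‖z - (p + c)‖ + ‖c‖ := by
        have : ‖(z - p) * κ‖^2 ≤ ‖z - (p + c)‖^2 + ‖c‖^2 := by
          rw [← norm_pow, ← norm_pow, ← norm_pow, hs]
          exact norm_sub_le _ _
        refine le_of_sq_le_sq (a := ‖(z - p) * κ‖) ?_ (by positivity)
        nlinarith [norm_nonneg (z - (p + c)), norm_nonneg c]
      refine (norm_sub_le _ _).trans ?_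
      linarith
    · have hre : 0 < κ.re := by
        rw [hκ, (hl2 z hz).2 hz2]
        have hα : ‖(a - p) / (z - p)‖ < 1 := by
          rw [norm_div, div_lt_one (by positivity)]; linarith
        have h1 := abs_lt.1 (arg_bd (one_sub_re_pos hα))
        rw [Complex.exp_re]
        have : (Complex.log (1 - (a - p) / (z - p)) / 2).im = (Complex.log (1 - (a - p) / (z - p))).im / 2 := by
          simp
        rw [this]
        have := Real.pi_pos
        exact mul_pos (Real.exp_pos _) (Real.cos_pos_of_mem_Ioo ⟨by linarith, by linarith⟩)
      have h1 : 1 ≤ ‖1 + κ‖ := by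
        have := Complex.abs_re_le_norm (1 + κ)
        have h3 : 1 ≤ |(1 + κ).re| := by
          rw [Complex.add_re, Complex.one_re, abs_of_pos (by linarith)]; linarith
        linarith
      have h10 : 1 + κ ≠ 0 := by rw [← norm_pos_iff]; linarith
      have e : (2 / c^2) * ((z - (p + c)) - (z - p) * κ) = 4 / ((z - p) * (1 + κ)^2) := by
        field_simp
        have hc' : c = (z - p) * (1 - κ^2) / 2 := by linear_combination (1/2) * hκ3
        rw [show z - (p + c) - (z - p) * κ = (z - p) - c - (z - p) * κ by ring, hc']
        ring
      show ‖(2 / c^2) * ((z - (p + c)) - (z - p) * κ)‖ ≤ _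
      rw [e, norm_div, norm_mul, norm_pow]
      have h4 : ‖(4:ℂ)‖ = 4 := by simp
      rw [h4]
      gcongr
      exact le_mul_of_one_le_right (norm_nonneg _) (one_le_pow₀ h1)

theorem Q_est {K : Set ℂ} (hK : IsCompact K) (hc : IsConnected Kᶜ) {p : ℂ} (hp : p ∉ K) :
    ∃ (m : ℂ) (g : ℂ → ℂ), PA K g ∧ ∀ ζ, ‖ζ - p‖ ≤ 2 → ∀ z ∈ K, z ≠ ζ →
      ‖(g z + (ζ - m) * (g z)^2) - (z - ζ)⁻¹‖ ≤ 10^8 / (‖z - ζ‖ * (1 + ‖z - ζ‖^2)) := by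
  obtain ⟨c, g, hg, hc1, hc2, h⟩ := exists_g hK hc hp
  refine ⟨p + c, g, hg, fun ζ hζ z hz hne => ?_⟩
  obtain ⟨h1, h2, h3⟩ := h z hz
  have hρ : 0 < ‖z - ζ‖ := norm_pos_iff.2 (sub_ne_zero.2 hne)
  set u := z - (p + c) with hu
  set η := ζ - (p + c) with hη
  have hzζ : z - ζ = u - η := by rw [hu, hη]; ring
  rw [hzζ] at hρ ⊢
  set ρ := ‖u - η‖ with hρd
  have hηn : ‖η‖ ≤ 3 := by
    have : η = (ζ - p) - c := by rw [hη]; ring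
    rw [this]; exact (norm_sub_le _ _).trans (by linarith)
  rw [le_div_iff₀ (by positivity)]
  have huz : u = (z - p) - c := by rw [hu]; ring
  rcases lt_or_ge ‖z - p‖ 6 with hz6 | hz6
  · have hun : ‖u‖ ≤ 7 := by rw [huz]; exact (norm_sub_le _ _).trans (by linarith)
    have hρ10 : ρ ≤ 10 := (norm_sub_le _ _).trans (by linarith)
    have hgn : ‖g z‖ ≤ 120 := by
      refine h2.trans ?_
      rw [div_le_iff₀ (by positivity)]
      nlinarith
    have hQ : ‖g z + η * g z ^ 2 - (u - η)⁻¹‖ ≤ 43320 + ρ⁻¹ := by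
      refine (norm_sub_le _ _).trans ?_
      rw [norm_inv]
      gcongr
      refine (norm_add_le _ _).trans ?_
      rw [norm_mul, norm_pow]
      have : ‖η‖ * ‖g z‖^2 ≤ 3 * 120^2 := by gcongr
      linarith
    calc _ ≤ (43320 + ρ⁻¹) * (ρ * (1 + ρ^2)) := by gcongr
      _ = (43320 * ρ + 1) * (1 + ρ^2) := by field_simp
      _ ≤ (43320 * 10 + 1) * (1 + 10^2) := by gcongr
      _ ≤ _ := by norm_num
  · have hun : ‖z - p‖ - 1 ≤ ‖u‖ := by
      rw [huz]
      have := norm_sub_norm_le (z - p) c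
      linarith
    have hu5 : 5 ≤ ‖u‖ := by linarith
    have hu0 : u ≠ 0 := by rw [← norm_pos_iff]; linarith
    set U := ‖u‖ with hU
    have hzp : 4/5 * U ≤ ‖z - p‖ := by
      have : U ≤ ‖z - p‖ + 1 := by
        rw [hU, huz]; exact (norm_sub_le _ _).trans (by linarith)
      linarith
    have hgn : ‖g z‖ ≤ 5 / U := by
      refine (h3 (by linarith)).trans ?_
      rw [div_le_div_iff₀ (by linarith) (by linarith)]
      linarith
    have hU0 : 0 < U := by linarith
    have hD : ‖g z - u⁻¹‖ ≤ 7 / U^3 := by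
      have : g z - u⁻¹ = c^2 / 4 * (g z)^2 / u := by
        field_simp
        linear_combination 4 * h1
      rw [this, norm_div, norm_mul, norm_div, norm_pow, norm_pow]
      have h4 : ‖(4:ℂ)‖ = 4 := by simp
      rw [h4]
      calc ‖c‖^2 / 4 * ‖g z‖^2 / U ≤ 1^2 / 4 * (5 / U)^2 / U := by gcongr
        _ = (25/4) / U^3 := by field_simp; norm_num
        _ ≤ _ := by gcongr; norm_num
    have hD2 : ‖g z ^ 2 - (u⁻¹)^2‖ ≤ 9 / U^3 := by
      rw [sq_sub_sq, norm_mul]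
      have : ‖g z + u⁻¹‖ ≤ 6 / U := by
        refine (norm_add_le _ _).trans ?_
        rw [norm_inv]
        calc _ ≤ 5 / U + U⁻¹ := by gcongr
          _ = 6 / U := by field_simp; norm_num
      calc _ ≤ (6 / U) * (7 / U^3) := by gcongr
        _ ≤ (6 / 5) * (7 / U^3) := by gcongr
        _ ≤ 9 / U^3 := by rw [← mul_div_assoc]; gcongr; norm_num
    have hρ1 : 2/5 * U ≤ ρ := by
      have := norm_sub_norm_le u η
      linarith
    have hρ2 : ρ ≤ 8/5 * U := by
      have := norm_sub_le u η
      linarith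
    have hne' : u - η ≠ 0 := by rw [← norm_pos_iff]; exact hρ
    have hT : ‖u⁻¹ + η * (u⁻¹)^2 - (u - η)⁻¹‖ ≤ 23 / U^3 := by
      have : u⁻¹ + η * (u⁻¹)^2 - (u - η)⁻¹ = - (η^2 / (u^2 * (u - η))) := by
        field_simp; ring
      rw [this, norm_neg, norm_div, norm_mul, norm_pow, norm_pow]
      calc ‖η‖^2 / (U^2 * ρ) ≤ 3^2 / (U^2 * (2/5 * U)) := by gcongr
        _ = (45/2) / U^3 := by field_simp; norm_num
        _ ≤ _ := by gcongr; norm_num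
    have htot : ‖g z + η * g z ^ 2 - (u - η)⁻¹‖ ≤ 57 / U^3 := by
      calc _ = ‖(g z - u⁻¹) + η * (g z ^ 2 - (u⁻¹)^2) + (u⁻¹ + η * (u⁻¹)^2 - (u - η)⁻¹)‖ := by
            congr 1; ring
        _ ≤ 7 / U^3 + 3 * (9 / U^3) + 23 / U^3 := by
            refine (norm_add_le _ _).trans (add_le_add ((norm_add_le _ _).trans (add_le_add hD ?_)) hT)
            rw [norm_mul]; gcongr
        _ = _ := by ring
    calc _ ≤ 57 / U^3 * ((8/5*U) * (U^2 + (8/5*U)^2)) := by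
          gcongr
          nlinarith
      _ = 57 * (8/5 * (1 + 64/25)) := by field_simp; norm_num
      _ ≤ _ := by norm_num


open MeasureTheory in
theorem ker_int : Integrable (fun x : ℂ => 1 / (‖x‖ * (1 + ‖x‖^2))) := by
  refine (integrable_fun_norm_addHaar (volume : Measure ℂ)
    (f := fun y : ℝ => 1 / (y * (1 + y^2)))).2 ?_
  refine (integrable_inv_one_add_sq.integrableOn (s := Set.Ioi 0)).congr_fun ?_ measurableSet_Ioi
  intro y (hy : 0 < y)
  simp [Complex.finrank_real_complex]
  field_simp

open MeasureTheory in
theorem cauchy_int {D : ℂ → ℂ} (hD : Continuous D) (hc : HasCompactSupport D) (z : ℂ) :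
    Integrable (fun ζ => D ζ * (z - ζ)⁻¹) := by
  have h1 : Continuous fun ζ => D ζ * ((1 + ‖z - ζ‖^2 : ℝ) : ℂ) := by fun_prop
  obtain ⟨M, hM⟩ := (hc.mul_right (f' := fun ζ => ((1 + ‖z - ζ‖^2 : ℝ) : ℂ))).exists_bound_of_continuous h1
  have h2 := (ker_int.comp_sub_left z).const_mul M
  refine h2.mono' ?_ (Eventually.of_forall fun ζ => ?_)
  · exact (hD.measurable.mul (by fun_prop)).aestronglyMeasurable
  · have := hM ζ
    simp only [Pi.mul_apply] at this
    rw [norm_mul, Complex.norm_real, Real.norm_of_nonneg (by positivity)] at this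
    rw [norm_mul, norm_inv]
    rcases eq_or_ne ‖z - ζ‖ 0 with h0 | h0
    · simp [h0]
    have hp : 0 < ‖z - ζ‖ := lt_of_le_of_ne (norm_nonneg _) h0.symm
    rw [← div_eq_mul_inv, mul_one_div, div_le_div_iff₀ hp (by positivity)]
    nlinarith

open MeasureTheory in
theorem vit_sum {K : Set ℂ} (hK : IsCompact K) (hc : IsConnected Kᶜ) {D : ℂ → ℂ} (hD : Continuous D)
    (hDc : HasCompactSupport D) {M : ℝ} (hM : ∀ ζ, ‖D ζ‖ ≤ M) (s : Finset ℂ) (hs : ∀ p ∈ s, p ∉ K) :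
    ∀ X : Set ℂ, MeasurableSet X → X ⊆ ⋃ p ∈ s, ball p 2 →
      ∃ F : ℂ → ℂ, PA K F ∧ ∀ z ∈ K, ‖F z - ∫ ζ in X, D ζ * (z - ζ)⁻¹‖ ≤
        ∫ ζ in X, M * 10^8 * (1 / (‖z - ζ‖ * (1 + ‖z - ζ‖^2))) := by
  classical
  have hI := fun z => cauchy_int hD hDc z
  have hJ : ∀ z : ℂ, Integrable fun ζ => M * 10^8 * (1 / (‖z - ζ‖ * (1 + ‖z - ζ‖^2))) :=
    fun z => (ker_int.comp_sub_left z).const_mul _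
  have hDi : Integrable D := hD.integrable_of_hasCompactSupport hDc
  induction s using Finset.induction_on with
  | empty =>
    intro X hX hX2
    have : X = ∅ := by simpa using hX2
    subst this
    exact ⟨fun _ => 0, PA.const K 0, by simp⟩
  | insert p s hp ih =>
    intro X hX hX2
    obtain ⟨F, hF, hF2⟩ := ih (fun q hq => hs q (Finset.mem_insert_of_mem hq)) (X \ ball p 2)
      (hX.diff measurableSet_ball) (by
        rintro x ⟨h1, h2⟩
        have := hX2 h1
        simp only [Finset.mem_insert, Set.iUnion_iUnion_eq_or_left, Set.mem_union] at this
        exact this.resolve_left h2)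
    obtain ⟨m, g, hg, hQ⟩ := Q_est hK hc (hs p (Finset.mem_insert_self _ _))
    have hDm : Integrable fun ζ => D ζ * (ζ - m) :=
      (hD.mul (by fun_prop : Continuous fun ζ : ℂ => ζ - m)).integrable_of_hasCompactSupport hDc.mul_right
    set Y := X ∩ ball p 2 with hY
    have hYm : MeasurableSet Y := hX.inter measurableSet_ball
    refine ⟨fun z => ((∫ ζ in Y, D ζ) * g z + (∫ ζ in Y, D ζ * (ζ - m)) * (g z * g z)) + F z,
      (((PA.const K _).mul hK hg).add ((PA.const K _).mul hK (hg.mul hK hg))).add hF, fun z hz => ?_⟩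
    rw [← integral_inter_add_sdiff measurableSet_ball (hI z).integrableOn,
      ← integral_inter_add_sdiff measurableSet_ball (hJ z).integrableOn, add_sub_add_comm]
    refine (norm_add_le _ _).trans (add_le_add ?_ (hF2 z hz))
    have e : (∫ ζ in Y, D ζ) * g z + (∫ ζ in Y, D ζ * (ζ - m)) * (g z * g z) -
        ∫ ζ in Y, D ζ * (z - ζ)⁻¹ = ∫ ζ in Y, D ζ * ((g z + (ζ - m) * (g z)^2) - (z - ζ)⁻¹) := by
      rw [← integral_mul_const, ← integral_mul_const, ← integral_add, ← integral_sub]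
      · congr 1; ext ζ; ring
      · exact (hDi.integrableOn.mul_const _).add (hDm.integrableOn.mul_const _)
      · exact (hI z).integrableOn
      · exact hDi.integrableOn.mul_const _
      · exact hDm.integrableOn.mul_const _
    rw [← hY, e]
    refine norm_integral_le_of_norm_le (hJ z).integrableOn ?_
    rw [ae_restrict_iff' hYm]
    have : ∀ᵐ ζ : ℂ, ζ ≠ z := by simp [ae_iff]
    filter_upwards [this] with ζ h1 h2
    rw [norm_mul, mul_assoc, mul_one_div]
    have h3 : ‖ζ - p‖ ≤ 2 := (mem_ball_iff_norm.1 h2.2).le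
    exact mul_le_mul (hM ζ) (hQ ζ h3 z hz h1.symm) (norm_nonneg _) ((norm_nonneg _).trans (hM 0))


noncomputable def bmp : ContDiffBump (0:ℂ) := ⟨1/2, 1, by norm_num, by norm_num⟩

noncomputable def bA : ℂ → ℝ := bmp.normed MeasureTheory.volume

noncomputable def bB (t : ℂ) : ℂ := ((fderiv ℝ bA t 1 : ℝ) + Complex.I * (fderiv ℝ bA t Complex.I : ℝ)) / 2

open MeasureTheory in
noncomputable def bPhi (f : ℂ → ℂ) : ℂ → ℂ := fun z => ∫ t, bA t • f (z - t)

open MeasureTheory Convolution in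
theorem bPhi_eq (f : ℂ → ℂ) : bPhi f = (bA ⋆[ContinuousLinearMap.lsmul ℝ ℝ, volume] f) := rfl

theorem bA_contDiff : ContDiff ℝ 1 bA := bmp.contDiff_normed
theorem bA_supp : HasCompactSupport bA := bmp.hasCompactSupport_normed

theorem bB_cont : Continuous bB := by
  have := bA_contDiff.continuous_fderiv one_ne_zero
  unfold bB
  fun_prop

theorem bB_supp : HasCompactSupport bB := by
  have := bA_supp.fderiv (𝕜 := ℝ)
  refine HasCompactSupport.mono this ?_
  intro t ht h0
  apply ht
  simp [bB, h0]

theorem bA_zero {t : ℂ} (ht : 1 ≤ ‖t‖) : bA t = 0 := by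
  have h : Function.support bA = ball 0 1 := bmp.support_normed_eq
  by_contra h0
  have : t ∈ ball (0:ℂ) 1 := by rw [← h]; exact h0
  rw [mem_ball_zero_iff] at this
  linarith

theorem bB_zero {t : ℂ} (ht : 1 < ‖t‖) : bB t = 0 := by
  have : bA =ᶠ[𝓝 t] fun _ => 0 := by
    filter_upwards [continuous_norm.continuousAt.eventually (lt_mem_nhds ht)] with s hs
    exact bA_zero hs.le
  simp [bB, this.fderiv_eq]

open MeasureTheory Convolution in
theorem bPhi_contDiff {f : ℂ → ℂ} (hf : Continuous f) : ContDiff ℝ 1 (bPhi f) := by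
  rw [bPhi_eq]
  exact bA_supp.contDiff_convolution_left (n := 1) _ bA_contDiff hf.locallyIntegrable

open MeasureTheory Convolution in
theorem bPhi_supp {f : ℂ → ℂ} (hf : HasCompactSupport f) : HasCompactSupport (bPhi f) := by
  rw [bPhi_eq]
  exact bA_supp.convolution _ hf

open MeasureTheory Convolution in
theorem bPhi_near {f : ℂ → ℂ} (hf : Continuous f) {ω : ℝ} {z : ℂ}
    (h : ∀ x, ‖x - z‖ < 1 → ‖f x - f z‖ ≤ ω) : ‖bPhi f z - f z‖ ≤ ω := by
  rw [bPhi_eq, ← dist_eq_norm]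
  refine ContDiffBump.dist_normed_convolution_le (φ := bmp) hf.aestronglyMeasurable ?_
  intro x hx
  rw [dist_eq_norm]
  exact h x (mem_ball_iff_norm.1 hx)

open MeasureTheory Convolution in
theorem bPhi_dbar {f : ℂ → ℂ} (hf : Continuous f) (z : ℂ) :
    dbar (bPhi f) z = ∫ t, bB t * f (z - t) := by
  have h := bA_supp.hasFDerivAt_convolution_left (ContinuousLinearMap.lsmul ℝ ℝ) bA_contDiff
    (hf.locallyIntegrable (μ := volume)) z
  rw [← bPhi_eq] at h
  have hcd := bA_contDiff.continuous_fderiv one_ne_zero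
  have hex := (bA_supp.fderiv (𝕜 := ℝ)).convolutionExists_left
    ((ContinuousLinearMap.lsmul ℝ ℝ (E := ℂ)).precompL ℂ) hcd (hf.locallyIntegrable (μ := volume)) z
  have key : ∀ v : ℂ, fderiv ℝ (bPhi f) z v = ∫ t, ((fderiv ℝ bA t v : ℝ) : ℂ) * f (z - t) := by
    intro v
    rw [h.fderiv, convolution_def, ContinuousLinearMap.integral_apply hex]
    congr 1
  have hi : ∀ v : ℂ, Integrable fun t => ((fderiv ℝ bA t v : ℝ) : ℂ) * f (z - t) := by
    intro v
    refine Continuous.integrable_of_hasCompactSupport (by fun_prop) ?_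
    refine HasCompactSupport.mono (bA_supp.fderiv (𝕜 := ℝ)) ?_
    intro t ht h0
    apply ht
    simp [h0]
  rw [dbar, key, key, ← integral_const_mul, ← integral_add (hi _) ((hi _).const_mul _),
    ← integral_div]
  congr 1; ext t; rw [bB]; ring

open MeasureTheory in
theorem bB_int_zero : ∫ t, bB t = 0 := by
  have h := bPhi_dbar (f := fun _ => 1) continuous_const 0
  simp only [mul_one] at h
  rw [← h]
  have : bPhi (fun _ => 1) = fun _ => ∫ t, bA t • (1:ℂ) := rfl
  rw [this]; simp [dbar]

open MeasureTheory in
theorem bPhi_dbar_le {f : ℂ → ℂ} (hf : Continuous f) {ω : ℝ} {z : ℂ}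
    (h : ∀ x, ‖x - z‖ ≤ 1 → ‖f x - f z‖ ≤ ω) : ‖dbar (bPhi f) z‖ ≤ ω * ∫ t, ‖bB t‖ := by
  have hBi : Integrable bB := bB_cont.integrable_of_hasCompactSupport bB_supp
  have hi : Integrable fun t => bB t * f (z - t) :=
    (bB_cont.mul (by fun_prop : Continuous fun t => f (z - t))).integrable_of_hasCompactSupport bB_supp.mul_right
  have e : dbar (bPhi f) z = ∫ t, bB t * (f (z - t) - f z) := by
    simp_rw [mul_sub]
    rw [integral_sub hi (hBi.mul_const _), integral_mul_const, bB_int_zero, bPhi_dbar hf]; simp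
  rw [e, ← integral_const_mul]
  refine norm_integral_le_of_norm_le (hBi.norm.const_mul _) (Eventually.of_forall fun t => ?_)
  rw [norm_mul, mul_comm]
  rcases lt_or_ge 1 ‖t‖ with h1 | h1
  · simp [bB_zero h1]
  · gcongr
    apply h; simpa using h1

theorem dbar_eq_zero {φ : ℂ → ℂ} {z : ℂ} (h : DifferentiableAt ℂ φ z) : dbar φ z = 0 := by
  have := h.hasDerivAt.complexToReal_fderiv.fderiv
  rw [dbar, this]
  simp
  linear_combination (deriv φ z) * Complex.I_sq

open MeasureTheory in
theorem bPhi_holo {f : ℂ → ℂ} (hf : Continuous f) {z : ℂ} {R : ℝ} (hR : 1 < R)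
    (h : DifferentiableOn ℂ f (ball z R)) : DifferentiableAt ℂ (bPhi f) z := by
  obtain ⟨δ, hδ, hδR⟩ : ∃ δ : ℝ, 0 < δ ∧ 1 + δ < R := ⟨(R - 1)/2, by linarith, by linarith⟩
  have hd : ContinuousOn (deriv f) (closedBall z (1 + δ)) :=
    ((h.deriv isOpen_ball).continuousOn).mono (closedBall_subset_ball hδR)
  obtain ⟨M, hM⟩ := (isCompact_closedBall z (1+δ)).exists_bound_of_continuousOn hd
  have hAc := bA_contDiff.continuous
  have hA : Integrable bA := hAc.integrable_of_hasCompactSupport bA_supp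
  refine (hasDerivAt_integral_of_dominated_loc_of_deriv_le (μ := volume) (𝕜 := ℂ)
    (F := fun w t => bA t • f (w - t)) (F' := fun w t => bA t • deriv f (w - t)) (bound := fun t => ‖bA t‖ * M)
    (s := ball z δ) (ball_mem_nhds z hδ) ?_ ?_ ?_ ?_ ?_ ?_).2.differentiableAt
  · exact Eventually.of_forall fun w => (by fun_prop : Continuous fun t => bA t • f (w - t)).aestronglyMeasurable
  · exact (by fun_prop : Continuous fun t => bA t • f (z - t)).integrable_of_hasCompactSupport bA_supp.smul_right
  · have := measurable_deriv f
    exact (hAc.measurable.smul (this.comp (by fun_prop : Measurable fun t : ℂ => z - t))).aestronglyMeasurable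
  · refine Eventually.of_forall fun t w hw => ?_
    rw [norm_smul]
    rcases le_or_gt 1 ‖t‖ with h1 | h1
    · simp [bA_zero h1]
    · gcongr
      apply hM
      rw [mem_closedBall_iff_norm]
      rw [mem_ball_iff_norm] at hw
      calc ‖w - t - z‖ = ‖(w - z) - t‖ := by congr 1; ring
        _ ≤ _ := norm_sub_le _ _
        _ ≤ _ := by linarith
  · exact hA.norm.mul_const _
  · refine Eventually.of_forall fun t w hw => ?_
    rcases le_or_gt 1 ‖t‖ with h1 | h1
    · simp [bA_zero h1]; exact hasDerivAt_const _ _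
    · have hm : w - t ∈ ball z R := by
        rw [mem_ball_iff_norm] at hw ⊢
        calc ‖w - t - z‖ = ‖(w - z) - t‖ := by congr 1; ring
          _ ≤ _ := norm_sub_le _ _
          _ < _ := by linarith
      have := (h.differentiableAt (isOpen_ball.mem_nhds hm)).hasDerivAt
      exact (this.comp_sub_const w t).const_smul (bA t)


open MeasureTheory in
theorem merg_scale : ∃ C : ℝ, 0 ≤ C ∧ ∀ K : Set ℂ, IsCompact K → IsConnected Kᶜ → ∀ f : ℂ → ℂ,
    Continuous f → HasCompactSupport f → DifferentiableOn ℂ f (interior K) → ∀ ω : ℝ,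
    (∀ z w, ‖z - w‖ ≤ 1 → ‖f z - f w‖ ≤ ω) →
    ∃ F, PA K F ∧ ∀ z ∈ K, ‖f z - F z‖ ≤ C * ω := by
  have hB0 : 0 ≤ ∫ t, ‖bB t‖ := integral_nonneg fun _ => norm_nonneg _
  have hk0 : 0 ≤ ∫ x : ℂ, 1 / (‖x‖ * (1 + ‖x‖^2)) := integral_nonneg fun _ => by positivity
  set CB := ∫ t, ‖bB t‖ with hCB
  set Ck := ∫ x : ℂ, 1 / (‖x‖ * (1 + ‖x‖^2)) with hCk
  refine ⟨1 + CB * 10^8 * Ck / Real.pi, by positivity, ?_⟩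
  intro K hK hc f hf hfc hfd ω hω
  have hω0 : 0 ≤ ω := (norm_nonneg _).trans (hω 0 0 (by simp))
  set Φ := bPhi f with hΦ
  have hΦd := bPhi_contDiff hf
  have hΦc := bPhi_supp hfc
  have hDf := hΦd.continuous_fderiv one_ne_zero
  have hD : Continuous (dbar Φ) := by unfold dbar; fun_prop
  have hDc : HasCompactSupport (dbar Φ) := by
    refine HasCompactSupport.mono (hΦc.fderiv (𝕜 := ℝ)) ?_
    intro t ht h0
    apply ht
    simp only [dbar]; rw [h0]; simp
  have hM : ∀ ζ, ‖dbar Φ ζ‖ ≤ ω * CB := fun ζ => bPhi_dbar_le hf fun x hx => hω _ _ hx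
  have hcov : tsupport (dbar Φ) ⊆ ⋃ p ∈ Kᶜ, ball p 2 := by
    intro ζ hζ
    obtain ⟨ζ', h1, h2⟩ := Metric.mem_closure_iff.1 hζ (1/4) (by norm_num)
    have h3 : ¬ ball ζ' (3/2) ⊆ interior K := by
      intro hsub
      exact h1 (dbar_eq_zero (bPhi_holo hf (by norm_num : (1:ℝ) < 3/2) (hfd.mono hsub)))
    have h4 : ¬ ball ζ' (3/2) ⊆ K := fun h => h3 (interior_maximal h isOpen_ball)
    obtain ⟨p, hp1, hp2⟩ := Set.not_subset.1 h4
    simp only [Set.mem_iUnion]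
    refine ⟨p, hp2, ?_⟩
    rw [mem_ball] at hp1 ⊢
    calc dist ζ p ≤ dist ζ ζ' + dist ζ' p := dist_triangle _ _ _
      _ < 2 := by rw [dist_comm ζ' p]; linarith
  obtain ⟨s, hs1, hs2⟩ := hDc.isCompact.elim_finite_subcover_image (fun p _ => isOpen_ball) hcov
  obtain ⟨hs2, hs3⟩ := hs2
  obtain ⟨F, hF, hF2⟩ := vit_sum hK hc hD hDc hM hs2.toFinset (fun p hp => hs1 (by simpa using hp))
    (tsupport (dbar Φ)) (isClosed_tsupport _).measurableSet (by simpa using hs3)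
  refine ⟨fun z => (1 / Real.pi : ℂ) * F z, (PA.const K _).mul hK hF, fun z hz => ?_⟩
  have hpi := Real.pi_pos
  have hpi' : (Real.pi : ℂ) ≠ 0 := by exact_mod_cast hpi.ne'
  have e1 : ∫ ζ in tsupport (dbar Φ), dbar Φ ζ * (z - ζ)⁻¹ = Real.pi * Φ z := by
    rw [setIntegral_eq_integral_of_forall_compl_eq_zero]
    · have := pompeiu hΦd hΦc z
      have e : (fun ζ => dbar Φ ζ * (z - ζ)⁻¹) = fun ζ => - (dbar Φ ζ * (ζ - z)⁻¹) := by
        ext ζ; rw [← neg_sub ζ z, inv_neg]; ring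
      rw [e, integral_neg, this, neg_neg]
    · intro ζ hζ
      rw [image_eq_zero_of_notMem_tsupport hζ, zero_mul]
  have h2 := hF2 z hz
  rw [e1] at h2
  have h3 : ∫ ζ in tsupport (dbar Φ), ω * CB * 10^8 * (1 / (‖z - ζ‖ * (1 + ‖z - ζ‖^2))) ≤
      ω * CB * 10^8 * Ck := by
    refine (setIntegral_le_integral ((ker_int.comp_sub_left z).const_mul _)
      (Eventually.of_forall fun ζ => by simp only [Pi.zero_apply]; positivity)).trans ?_
    rw [integral_const_mul, integral_sub_left_eq_self (fun x : ℂ => 1 / (‖x‖ * (1 + ‖x‖^2))) volume z]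
  have h4 : ‖(1 / Real.pi : ℂ) * F z - Φ z‖ ≤ (ω * CB * 10^8 * Ck) / Real.pi := by
    have : (1 / Real.pi : ℂ) * F z - Φ z = (F z - Real.pi * Φ z) / Real.pi := by field_simp
    rw [this, norm_div, Complex.norm_real, Real.norm_of_nonneg hpi.le]
    gcongr
    exact h2.trans h3
  have h5 : ‖Φ z - f z‖ ≤ ω := bPhi_near hf fun x hx => hω _ _ hx.le
  calc ‖f z - (1 / Real.pi : ℂ) * F z‖ = ‖((1 / Real.pi : ℂ) * F z - Φ z) + (Φ z - f z)‖ := by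
        rw [← norm_neg]; congr 1; ring
    _ ≤ _ := norm_add_le _ _
    _ ≤ (ω * CB * 10^8 * Ck) / Real.pi + ω := add_le_add h4 h5
    _ = _ := by ring

theorem PA.comp_mul {K K' : Set ℂ} {F : ℂ → ℂ} (hF : PA K' F) (c : ℂ) (h : ∀ z ∈ K, c * z ∈ K') :
    PA K (fun z => F (c * z)) := by
  intro ε hε
  obtain ⟨p, hp⟩ := hF ε hε
  refine ⟨p.comp (Polynomial.C c * Polynomial.X), fun z hz => ?_⟩
  simpa using hp _ (h z hz)

theorem mergelyan_cs {K : Set ℂ} (hK : IsCompact K) (hc : IsConnected Kᶜ) {f : ℂ → ℂ}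
    (hf : Continuous f) (hfc : HasCompactSupport f) (hfd : DifferentiableOn ℂ f (interior K)) :
    PA K f := by
  obtain ⟨C, hC0, hC⟩ := merg_scale
  refine PA.limit fun ε hε => ?_
  have hu := hfc.uniformContinuous_of_continuous hf
  obtain ⟨δ, hδ, hu⟩ := Metric.uniformContinuous_iff.1 hu (ε / (C + 1)) (by positivity)
  set d : ℝ := δ / 2 with hd
  have hd0 : 0 < d := by positivity
  have hdC : (d : ℂ) ≠ 0 := by exact_mod_cast hd0.ne'
  let e : ℂ ≃ₜ ℂ := Homeomorph.mulLeft₀ (d : ℂ) hdC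
  have he : ∀ z, e z = d * z := fun z => rfl
  obtain ⟨F, hF, hF2⟩ := hC (e ⁻¹' K) (e.isCompact_preimage.2 hK)
    (by rw [← Set.preimage_compl]; exact ⟨by obtain ⟨x, hx⟩ := hc.1; exact ⟨e.symm x, by simpa using hx⟩, e.isPreconnected_preimage.2 hc.2⟩)
    (fun z => f (d * z)) (by fun_prop) (hfc.comp_homeomorph e)
    (by
      rw [← e.preimage_interior]
      exact hfd.comp (by fun_prop) (fun z hz => hz)) (ε / (C + 1)) (by
      intro z w hzw
      rw [← dist_eq_norm]
      refine (hu ?_).le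
      rw [dist_eq_norm, ← mul_sub, norm_mul, Complex.norm_real, Real.norm_of_nonneg hd0.le]
      nlinarith)
  refine ⟨fun z => F ((d:ℂ)⁻¹ * z), hF.comp_mul _ ?_, fun z hz => ?_⟩
  · intro z hz
    show (d:ℂ) * ((d:ℂ)⁻¹ * z) ∈ K
    rwa [mul_inv_cancel_left₀ hdC]
  · have := hF2 ((d:ℂ)⁻¹ * z) (by
      show (d:ℂ) * ((d:ℂ)⁻¹ * z) ∈ K
      rwa [mul_inv_cancel_left₀ hdC])
    simp only [mul_inv_cancel_left₀ hdC] at this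
    refine this.trans ?_
    rw [mul_div_assoc', div_le_iff₀ (by positivity)]
    nlinarith

theorem mergelyan {K : Set ℂ} (hK : IsCompact K) (hc : IsConnected Kᶜ) {f : ℂ → ℂ}
    (hf : memA K f) : PA K f := by
  obtain ⟨g, hg⟩ : ∃ g : C(ℂ, ℂ), g.restrict K = ⟨_, hf.1.domRestrict⟩ :=
    ContinuousMap.exists_restrict_eq hK.isClosed _
  have hg' : ∀ z ∈ K, g z = f z := fun z hz => by
    have := congrArg (fun h : C(K, ℂ) => h ⟨z, hz⟩) hg
    simpa using this
  obtain ⟨χ, hχ1, _, hχ3, _⟩ := exists_continuous_one_zero_of_isCompact hK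
    (isClosed_empty) (Set.disjoint_empty K)
  have hcs : HasCompactSupport fun z => (χ z : ℂ) * g z := by
    refine HasCompactSupport.mono hχ3 ?_
    intro z hz h0; apply hz; simp [h0]
  have heq : ∀ z ∈ K, (χ z : ℂ) * g z = f z := fun z hz => by
    rw [hχ1 hz, hg' z hz]; simp
  refine (mergelyan_cs hK hc (f := fun z => (χ z : ℂ) * g z) (by fun_prop) hcs ?_).congr ?_
  · exact hf.2.congr fun z hz => heq z (interior_subset hz)
  · intro z hz; exact heq z hz


/-- Polynomial growth sets (sublevel sets of the Green function). -/
def SS (L : Set ℂ) (τ : ℝ) : Set ℂ :=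
  {z | ∀ (n : ℕ) (e : Polynomial ℂ), e.degree ≤ (n : ℕ) → (∀ w ∈ L, ‖e.eval w‖ ≤ 1) → ‖e.eval z‖ ≤ τ ^ n}

theorem SS_sub {L : Set ℂ} {τ : ℝ} (hτ : 1 ≤ τ) : L ⊆ SS L τ := by
  intro z hz n e _ he
  exact (he z hz).trans (one_le_pow₀ hτ)

theorem SS_closed (L : Set ℂ) (τ : ℝ) : IsClosed (SS L τ) := by
  have : SS L τ = ⋂ (n : ℕ) (e : Polynomial ℂ) (_ : e.degree ≤ (n : ℕ)) (_ : ∀ w ∈ L, ‖e.eval w‖ ≤ 1),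
      {z | ‖e.eval z‖ ≤ τ ^ n} := by
    ext z; simp [SS]
  rw [this]
  refine isClosed_iInter fun n => isClosed_iInter fun e => isClosed_iInter fun _ => isClosed_iInter fun _ => ?_
  exact isClosed_le (by fun_prop) continuous_const

theorem SS_scale {L : Set ℂ} {τ : ℝ} {z : ℂ} (hz : z ∈ SS L τ) {n : ℕ} {e : Polynomial ℂ}
    (he : e.degree ≤ (n : ℕ)) {M : ℝ} (hM : 0 < M) (h : ∀ w ∈ L, ‖e.eval w‖ ≤ M) :
    ‖e.eval z‖ ≤ M * τ ^ n := by
  have hMc : ((M:ℂ)⁻¹) ≠ 0 := inv_ne_zero (by exact_mod_cast hM.ne')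
  have := hz n (Polynomial.C ((M:ℂ)⁻¹) * e) (by rwa [Polynomial.degree_C_mul hMc]) (by
    intro w hw
    rw [Polynomial.eval_mul, Polynomial.eval_C, norm_mul, norm_inv, Complex.norm_real,
      Real.norm_of_nonneg hM.le, inv_mul_le_iff₀ hM, mul_one]
    exact h w hw)
  rwa [Polynomial.eval_mul, Polynomial.eval_C, norm_mul, norm_inv, Complex.norm_real,
      Real.norm_of_nonneg hM.le, inv_mul_le_iff₀ hM] at this

theorem SS_compact {L : Set ℂ} (hL : IsCompact L) (τ : ℝ) : IsCompact (SS L τ) := by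
  obtain ⟨R, hR0, hR⟩ := hL.isBounded.subset_closedBall_lt 0 0
  refine (isCompact_closedBall (0:ℂ) (R * τ)).of_isClosed_subset (SS_closed L τ) ?_
  intro z hz
  have := SS_scale hz (n := 1) (e := Polynomial.X) (by simp [Polynomial.degree_X]) hR0
    (fun w hw => by simpa using hR hw)
  simpa using this

theorem SS_thick {L : Set ℂ} {s : ℝ} (hs : 0 < s)
    (hL : ∀ a ∈ L, ∃ C ⊆ L, IsPreconnected C ∧ a ∈ C ∧ ∃ b ∈ C, s ≤ dist b a)
    {τ : ℝ} {θ : ℝ} (hθ : 0 < θ) {z : ℂ} (hz : z ∈ SS L τ) {w : ℂ}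
    (hw : dist w z ≤ s * (Real.cosh θ - 1) / 2) : w ∈ SS L (Real.exp θ * τ) := by
  intro n e he he1
  have := SS_scale hz (n := n) (e := e.comp (Polynomial.X + Polynomial.C (w - z)))
    (M := Real.exp θ ^ n) ?_ (by positivity) ?_
  · rw [mul_pow]
    simpa using this
  · rw [← Polynomial.natDegree_le_iff_degree_le] at he ⊢
    refine Polynomial.natDegree_comp_le.trans ?_
    rw [Polynomial.natDegree_X_add_C, mul_one]; exact he
  · intro a ha
    obtain ⟨C, hCL, hCc, haC, b, hb, hab⟩ := hL a ha
    have := hcp_pt hCc haC hb hs hab hθ.le he (M := 1) (fun x hx => he1 x (hCL hx)) (z := a + (w - z)) (by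
      rw [dist_eq_norm] at hw ⊢; simpa using hw)
    simpa using this

theorem SS_int {L : Set ℂ} {s : ℝ} (hs : 0 < s)
    (hL : ∀ a ∈ L, ∃ C ⊆ L, IsPreconnected C ∧ a ∈ C ∧ ∃ b ∈ C, s ≤ dist b a)
    {τ τ' : ℝ} (hτ : 0 < τ) (h : τ < τ') : SS L τ ⊆ interior (SS L τ') := by
  intro z hz
  rw [mem_interior_iff_mem_nhds]
  set θ := Real.log (τ' / τ) with hθd
  have h1 : 1 < τ' / τ := (one_lt_div hτ).2 h
  have hθ : 0 < θ := Real.log_pos h1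
  have he : Real.exp θ * τ = τ' := by
    rw [hθd, Real.exp_log (by positivity), div_mul_cancel₀ _ hτ.ne']
  have hc : 0 < s * (Real.cosh θ - 1) / 2 := by
    have := Real.one_lt_cosh.2 hθ.ne'
    have : 0 < Real.cosh θ - 1 := by linarith
    positivity
  filter_upwards [closedBall_mem_nhds z hc] with w hw
  rw [← he]
  exact SS_thick hs hL hθ hz hw

theorem ext_holo {L : Set ℂ} {s : ℝ} (hs : 0 < s)
    (hL : ∀ a ∈ L, ∃ C ⊆ L, IsPreconnected C ∧ a ∈ C ∧ ∃ b ∈ C, s ≤ dist b a)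
    {F : ℂ → ℂ} {r1 r : ℝ} (h1 : 0 < r1) (h12 : r1 < r)
    {N : ℕ} {p : ℕ → Polynomial ℂ} (hp : ∀ n, N ≤ n → (p n).degree ≤ (n : ℕ))
    (hpF : ∀ n, N ≤ n → ∀ z ∈ L, ‖F z - (p n).eval z‖ ≤ r1 ^ n) (hr1 : r < 1) :
    ∃ (U : Set ℂ) (G : ℂ → ℂ), IsOpen U ∧ SS L (1 / r) ⊆ U ∧ DifferentiableOn ℂ G U ∧
      ∀ z ∈ L, G z = F z := by
  obtain ⟨r2, h2, h3⟩ := exists_between h12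
  have h20 : 0 < r2 := h1.trans h2
  set f : ℕ → ℂ → ℂ := fun k z => (p (N + k + 1)).eval z - (p (N + k)).eval z with hf
  have hbound : ∀ k, ∀ z ∈ SS L (1 / r2), ‖f k z‖ ≤ 2 / r2 * (r1 / r2) ^ (N + k) := by
    intro k z hz
    have := SS_scale hz (n := N + k + 1) (e := p (N + k + 1) - p (N + k)) (M := 2 * r1 ^ (N + k)) ?_ (by positivity) ?_
    · simp only [hf]
      rw [Polynomial.eval_sub] at this
      refine this.trans (le_of_eq ?_)
      rw [div_pow, div_pow, pow_succ]; field_simp; ring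
    · refine (Polynomial.degree_sub_le _ _).trans (max_le (hp _ (by omega)) ((hp _ (by omega)).trans ?_))
      exact_mod_cast Nat.le_succ _
    · intro w hw
      have a1 := hpF (N + k + 1) (by omega) w hw
      have a2 := hpF (N + k) (by omega) w hw
      have a3 : r1 ^ (N + k + 1) ≤ r1 ^ (N + k) := pow_le_pow_of_le_one h1.le (by linarith) (Nat.le_succ _)
      rw [Polynomial.eval_sub]
      calc _ = ‖(F w - (p (N + k)).eval w) - (F w - (p (N + k + 1)).eval w)‖ := by congr 1; ring
        _ ≤ _ := norm_sub_le _ _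
        _ ≤ _ := by linarith
  have hq : r1 / r2 < 1 := (div_lt_one h20).2 h2
  have hsum : Summable fun k => 2 / r2 * (r1 / r2) ^ (N + k) := by
    refine Summable.mul_left _ ?_
    simp_rw [pow_add]
    exact (summable_geometric_of_lt_one (by positivity) hq).mul_left _
  refine ⟨interior (SS L (1 / r2)), fun z => (p N).eval z + ∑' k, f k z, isOpen_interior,
    SS_int hs hL (by have := h20.trans h3; positivity) (by gcongr), ?_, ?_⟩
  · refine DifferentiableOn.add ((p N).differentiable.differentiableOn) ?_
    exact Complex.differentiableOn_tsum_of_summable_norm hsum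
      (fun k => (((p _).differentiable).sub (p _).differentiable).differentiableOn) isOpen_interior
      (fun k z hz => hbound k z (interior_subset hz))
  · intro z hz
    have hz' : z ∈ SS L (1 / r2) := SS_sub ((one_le_div h20).2 (by linarith)) hz
    have hs1 : Summable fun k => f k z := Summable.of_norm_bounded hsum fun k => hbound k z hz'
    have ht := hs1.hasSum.tendsto_sum_nat
    have e : ∀ k, ∑ i ∈ Finset.range k, f i z = (p (N + k)).eval z - (p N).eval z := by
      intro k
      exact Finset.sum_range_sub (fun k => (p (N + k)).eval z) k
    simp_rw [e] at ht
    have ht2 : Tendsto (fun k => (p (N + k)).eval z - (p N).eval z) atTop (𝓝 (F z - (p N).eval z)) := by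
      refine Tendsto.sub_const ?_ _
      rw [tendsto_iff_norm_sub_tendsto_zero]
      refine squeeze_zero (fun _ => norm_nonneg _) (fun k => ?_)
        ((tendsto_pow_atTop_nhds_zero_of_lt_one h1.le (by linarith : r1 < 1)).comp (tendsto_add_atTop_nat N))
      rw [norm_sub_rev]
      simpa [add_comm k N] using hpF (N + k) (by omega) z hz
    beta_reduce
    rw [tendsto_nhds_unique ht ht2]; ring

theorem sep_open {U : Set ℂ} (hU : IsOpen U) {G : ℂ → ℂ} (hG : DifferentiableOn ℂ G U)
    {K0 P : Set ℂ} (hK0 : IsPreconnected K0) (hnt : K0.Nontrivial) (hKU : K0 ⊆ U) (hPU : P ⊆ U)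
    (h0 : ∀ z ∈ K0, G z = 0) (h1 : ∀ z ∈ P, G z ≠ 0) :
    ∃ V0 V1 : Set ℂ, IsOpen V0 ∧ IsOpen V1 ∧ Disjoint V0 V1 ∧ U ⊆ V0 ∪ V1 ∧ K0 ⊆ V0 ∧ P ⊆ V1 := by
  have han : ∀ z ∈ U, AnalyticAt ℂ G z := fun z hz => hG.analyticAt (hU.mem_nhds hz)
  refine ⟨{z | z ∈ U ∧ ∀ᶠ w in 𝓝 z, G w = 0}, {z | z ∈ U ∧ ∀ᶠ w in 𝓝[≠] z, G w ≠ 0}, ?_, ?_, ?_, ?_, ?_, ?_⟩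
  · rw [isOpen_iff_mem_nhds]
    rintro z ⟨hz, h⟩
    filter_upwards [hU.mem_nhds hz, h.eventually_nhds] with w hw hw2 using ⟨hw, hw2⟩
  · rw [isOpen_iff_mem_nhds]
    rintro z ⟨hz, h⟩
    have h' : ∀ᶠ w in 𝓝 z, ∀ᶠ x in 𝓝[≠] w, G x ≠ 0 := by
      rw [eventually_nhdsWithin_iff] at h
      filter_upwards [h.eventually_nhds] with w hw
      rcases eq_or_ne w z with rfl | hne
      · exact eventually_nhdsWithin_iff.2 (hw.mono fun x hx => hx)
      · have : ∀ᶠ x in 𝓝 w, x ≠ z := isOpen_ne.mem_nhds hne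
        exact (hw.and this).filter_mono nhdsWithin_le_nhds |>.mono fun x hx => hx.1 hx.2
    filter_upwards [hU.mem_nhds hz, h'] with w hw hw2 using ⟨hw, hw2⟩
  · rw [Set.disjoint_left]
    rintro z ⟨_, h2⟩ ⟨_, h3⟩
    obtain ⟨w, hw1, hw2⟩ := ((h2.filter_mono nhdsWithin_le_nhds).and h3).exists
    exact hw2 hw1
  · intro z hz
    rcases (han z hz).eventually_eq_zero_or_eventually_ne_zero with h | h
    · exact Or.inl ⟨hz, h⟩
    · exact Or.inr ⟨hz, h⟩
  · intro z hz
    refine ⟨hKU hz, ?_⟩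
    rcases (han z (hKU hz)).eventually_eq_zero_or_eventually_ne_zero with h | h
    · exact h
    · exfalso
      have hacc : AccPt z (𝓟 K0) := hK0.preperfect_of_nontrivial hnt z hz
      rw [accPt_iff_frequently_nhdsNE] at hacc
      obtain ⟨w, hw1, hw2⟩ := (hacc.and_eventually h).exists
      exact hw2 (h0 w hw1)
  · intro z hz
    refine ⟨hPU hz, ?_⟩
    exact ((han z (hPU hz)).continuousAt.eventually_ne (h1 z hz)).filter_mono nhdsWithin_le_nhds


theorem divdiff (E : Polynomial ℂ) {z ζ : ℂ} (h : z ≠ ζ) :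
    (E.eval z - E.eval ζ) * (z - ζ)⁻¹ =
      ∑ j ∈ Finset.range (E.natDegree + 1), ∑ i ∈ Finset.range j, E.coeff j * (z ^ i * ζ ^ (j - 1 - i)) := by
  have h' : z - ζ ≠ 0 := sub_ne_zero.2 h
  rw [← div_eq_mul_inv, div_eq_iff h', Polynomial.eval_eq_sum_range, Polynomial.eval_eq_sum_range, Finset.sum_mul,
    ← Finset.sum_sub_distrib]
  refine Finset.sum_congr rfl fun j _ => ?_
  rw [← Finset.mul_sum, mul_assoc, Commute.geom_sum₂_mul (Commute.all z ζ) j]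
  ring

open MeasureTheory in
theorem bw_piece {L : Set ℂ} {D : ℂ → ℂ} (hD : Continuous D)
    (hDc : HasCompactSupport D) {X : Set ℂ} (hX : MeasurableSet X) {d : ℝ} (hd : 0 < d)
    (hXd : ∀ ζ ∈ X, ∀ z ∈ L, d ≤ ‖z - ζ‖) {r : ℝ} (hr0 : 0 < r) (hr1 : r < 1)
    {n : ℕ} (hn : 1 ≤ n) {e : Polynomial ℂ} (he : e.degree ≤ (n : ℕ)) (he1 : ∀ z ∈ L, ‖e.eval z‖ ≤ 1)
    (hXe : ∀ ζ ∈ X, (1 / r) ^ n < ‖e.eval ζ‖) :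
    ∃ C : ℝ, 0 ≤ C ∧ ∀ N : ℕ, ∃ q : Polynomial ℂ, q.degree ≤ (N : ℕ) ∧ ∀ z ∈ L,
      ‖q.eval z - ∫ ζ in X, D ζ * (z - ζ)⁻¹‖ ≤ C * r ^ N := by
  have hDi : Integrable D := hD.integrable_of_hasCompactSupport hDc
  have hI := fun z => cauchy_int hD hDc z
  have hnn : 0 ≤ ∫ ζ in X, ‖D ζ‖ := integral_nonneg fun _ => norm_nonneg _
  refine ⟨(∫ ζ in X, ‖D ζ‖) / (d * r ^ n), by positivity, fun N => ?_⟩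
  set k := N / n with hk
  set E := e ^ k with hE
  have hEdeg : E.natDegree ≤ N := by
    rw [← Polynomial.natDegree_le_iff_degree_le] at he
    refine Polynomial.natDegree_pow_le.trans ((Nat.mul_le_mul_left k he).trans ?_)
    exact Nat.div_mul_le_self N n
  have hE1 : ∀ ζ ∈ X, 1 ≤ ‖E.eval ζ‖ ∧ ‖E.eval ζ‖⁻¹ ≤ r ^ N / r ^ n := by
    intro ζ hζ
    have h1 := hXe ζ hζ
    have h2 : ((1 / r) ^ n) ^ k ≤ ‖E.eval ζ‖ := by
      rw [hE, Polynomial.eval_pow, norm_pow]; gcongr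
    refine ⟨le_trans ?_ h2, ?_⟩
    · rw [← pow_mul]; exact one_le_pow₀ ((one_le_div hr0).2 hr1.le)
    · calc ‖E.eval ζ‖⁻¹ ≤ (((1 / r) ^ n) ^ k)⁻¹ := by gcongr
        _ = r ^ (n * k) := by rw [← pow_mul, one_div, inv_pow, inv_inv]
        _ ≤ _ := by
          rw [le_div_iff₀ (by positivity), ← pow_add]
          apply pow_le_pow_of_le_one hr0.le hr1.le
          have := Nat.div_add_mod N n
          have := Nat.mod_lt N hn
          rw [hk]; omega
  have hmeas : Measurable fun ζ => (E.eval ζ)⁻¹ := (by fun_prop : Continuous fun ζ => E.eval ζ).measurable.inv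
  have hIntg : ∀ m : ℕ, IntegrableOn (fun ζ => D ζ * (E.eval ζ)⁻¹ * ζ ^ m) X := by
    intro m
    have h1 : Integrable fun ζ => D ζ * ζ ^ m :=
      (hD.mul (by fun_prop : Continuous fun ζ : ℂ => ζ ^ m)).integrable_of_hasCompactSupport hDc.mul_right
    refine h1.integrableOn.norm.mono' ?_ ?_
    · exact ((hD.measurable.mul hmeas).mul (by fun_prop)).aestronglyMeasurable
    · rw [ae_restrict_iff' hX]
      refine Eventually.of_forall fun ζ hζ => ?_
      rw [norm_mul, norm_mul, norm_mul, norm_inv]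
      have := (hE1 ζ hζ).1
      have h3 : ‖E.eval ζ‖⁻¹ ≤ 1 := inv_le_one_of_one_le₀ this
      gcongr
      exact mul_le_of_le_one_right (norm_nonneg _) h3
  set c : ℕ → ℂ := fun m => ∫ ζ in X, D ζ * (E.eval ζ)⁻¹ * ζ ^ m with hc
  refine ⟨∑ j ∈ Finset.range (E.natDegree + 1), ∑ i ∈ Finset.range j,
    Polynomial.C (-(E.coeff j * c (j - 1 - i))) * Polynomial.X ^ i, ?_, ?_⟩
  · rw [← Polynomial.natDegree_le_iff_degree_le]
    refine Polynomial.natDegree_sum_le_of_forall_le _ _ fun j hj => ?_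
    refine Polynomial.natDegree_sum_le_of_forall_le _ _ fun i hi => ?_
    refine (Polynomial.natDegree_C_mul_X_pow_le _ _).trans ?_
    rw [Finset.mem_range] at hj hi
    omega
  · intro z hz
    have hne : ∀ ζ ∈ X, z ≠ ζ := by
      rintro ζ hζ rfl
      have := hXd z hζ z hz
      simp at this; linarith
    have hE0 : ∀ ζ ∈ X, E.eval ζ ≠ 0 := fun ζ hζ => by
      rw [← norm_pos_iff]; linarith [(hE1 ζ hζ).1]
    have e1 : Polynomial.eval z (∑ j ∈ Finset.range (E.natDegree + 1), ∑ i ∈ Finset.range j,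
        Polynomial.C (-(E.coeff j * c (j - 1 - i))) * Polynomial.X ^ i) =
        ∫ ζ in X, D ζ * (1 - E.eval z * (E.eval ζ)⁻¹) * (z - ζ)⁻¹ := by
      have : ∀ ζ ∈ X, D ζ * (1 - E.eval z * (E.eval ζ)⁻¹) * (z - ζ)⁻¹ =
          ∑ j ∈ Finset.range (E.natDegree + 1), ∑ i ∈ Finset.range j,
            (-(E.coeff j * z ^ i)) * (D ζ * (E.eval ζ)⁻¹ * ζ ^ (j - 1 - i)) := by
        intro ζ hζ
        have h1 := divdiff E (hne ζ hζ)
        have h2 := hE0 ζ hζ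
        calc _ = -(D ζ * (E.eval ζ)⁻¹) * ((E.eval z - E.eval ζ) * (z - ζ)⁻¹) := by
              field_simp; ring
          _ = _ := by
              rw [h1, Finset.mul_sum]
              refine Finset.sum_congr rfl fun j _ => ?_
              rw [Finset.mul_sum]
              refine Finset.sum_congr rfl fun i _ => ?_
              ring
      rw [setIntegral_congr_fun hX this, integral_finsetSum, Polynomial.eval_finsetSum]
      · refine Finset.sum_congr rfl fun j _ => ?_
        rw [integral_finsetSum, Polynomial.eval_finsetSum]
        · refine Finset.sum_congr rfl fun i _ => ?_
          rw [integral_const_mul]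
          simp only [hc, Polynomial.eval_mul, Polynomial.eval_C, Polynomial.eval_pow, Polynomial.eval_X]
          ring
        · intro i _; exact (hIntg _).const_mul _
      · intro j _
        exact integrable_finsetSum _ fun i _ => (hIntg _).const_mul _
    have hJ : IntegrableOn (fun ζ => D ζ * (E.eval z * (E.eval ζ)⁻¹) * (z - ζ)⁻¹) X := by
      have h1 : IntegrableOn (fun ζ => ‖E.eval z‖ * ‖D ζ * (z - ζ)⁻¹‖) X := ((hI z).norm.const_mul _).integrableOn
      refine h1.mono' ?_ ?_
      · exact ((hD.measurable.mul (measurable_const.mul hmeas)).mul (by fun_prop)).aestronglyMeasurable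
      · rw [ae_restrict_iff' hX]
        refine Eventually.of_forall fun ζ hζ => ?_
        simp only [norm_mul, norm_inv]
        have h3 : ‖E.eval ζ‖⁻¹ ≤ 1 := inv_le_one_of_one_le₀ (hE1 ζ hζ).1
        calc _ = (‖E.eval z‖ * (‖D ζ‖ * ‖z - ζ‖⁻¹)) * ‖E.eval ζ‖⁻¹ := by ring
          _ ≤ _ := mul_le_of_le_one_right (by positivity) h3
    have e2 : ∫ ζ in X, D ζ * (1 - E.eval z * (E.eval ζ)⁻¹) * (z - ζ)⁻¹ =
        (∫ ζ in X, D ζ * (z - ζ)⁻¹) - ∫ ζ in X, D ζ * (E.eval z * (E.eval ζ)⁻¹) * (z - ζ)⁻¹ := by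
      rw [← integral_sub (hI z).integrableOn hJ]
      congr 1; ext ζ; ring
    rw [e1, e2, sub_sub_cancel_left, norm_neg]
    have e3 : (∫ ζ in X, ‖D ζ‖) / (d * r ^ n) * r ^ N = ∫ ζ in X, ‖D ζ‖ * (r ^ N / (d * r ^ n)) := by
      rw [integral_mul_const]; ring
    rw [e3]
    refine norm_integral_le_of_norm_le (hDi.norm.mul_const _).integrableOn ?_
    rw [ae_restrict_iff' hX]
    refine Eventually.of_forall fun ζ hζ => ?_
    simp only [norm_mul, norm_inv]
    have h1 : ‖E.eval z‖ ≤ 1 := by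
      rw [hE, Polynomial.eval_pow, norm_pow]; exact pow_le_one₀ (norm_nonneg _) (he1 z hz)
    have h2 := (hE1 ζ hζ).2
    have h3 := hXd ζ hζ z hz
    calc ‖D ζ‖ * (‖E.eval z‖ * ‖E.eval ζ‖⁻¹) * ‖z - ζ‖⁻¹ ≤ ‖D ζ‖ * (1 * (r ^ N / r ^ n)) * d⁻¹ := by gcongr
      _ = _ := by field_simp

open MeasureTheory in
theorem bw_sum {L : Set ℂ} {D : ℂ → ℂ} (hD : Continuous D)
    (hDc : HasCompactSupport D) {d : ℝ} (hd : 0 < d) {r : ℝ} (hr0 : 0 < r) (hr1 : r < 1)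
    (s : Finset (ℕ × Polynomial ℂ)) (hs : ∀ x ∈ s, 1 ≤ x.1 ∧ x.2.degree ≤ (x.1 : ℕ) ∧ ∀ z ∈ L, ‖x.2.eval z‖ ≤ 1) :
    ∀ X : Set ℂ, MeasurableSet X → (∀ ζ ∈ X, ∀ z ∈ L, d ≤ ‖z - ζ‖) →
      (∀ ζ ∈ X, ∃ x ∈ s, (1 / r) ^ x.1 < ‖x.2.eval ζ‖) →
    ∃ C : ℝ, 0 ≤ C ∧ ∀ N : ℕ, ∃ q : Polynomial ℂ, q.degree ≤ (N : ℕ) ∧ ∀ z ∈ L,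
      ‖q.eval z - ∫ ζ in X, D ζ * (z - ζ)⁻¹‖ ≤ C * r ^ N := by
  classical
  have hI := fun z => cauchy_int hD hDc z
  induction s using Finset.induction_on with
  | empty =>
    intro X hX _ hX2
    have : X = ∅ := by
      rw [Set.eq_empty_iff_forall_notMem]; intro ζ hζ; simpa using hX2 ζ hζ
    subst this
    exact ⟨0, le_rfl, fun N => ⟨0, by simp, by simp⟩⟩
  | insert p s hp ih =>
    intro X hX hXd hX2
    set Y := {ζ : ℂ | (1 / r) ^ p.1 < ‖p.2.eval ζ‖} with hY
    have hYm : MeasurableSet Y := (isOpen_lt continuous_const (by fun_prop)).measurableSet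
    obtain ⟨C1, hC1, h1⟩ := ih (fun x hx => hs x (Finset.mem_insert_of_mem hx)) (X \ Y) (hX.diff hYm)
      (fun ζ hζ => hXd ζ hζ.1) (by
        intro ζ hζ
        obtain ⟨x, hx, hx2⟩ := hX2 ζ hζ.1
        rcases Finset.mem_insert.1 hx with rfl | hx
        · exact absurd hx2 hζ.2
        · exact ⟨x, hx, hx2⟩)
    obtain ⟨a1, a2, a3⟩ := hs p (Finset.mem_insert_self _ _)
    obtain ⟨C2, hC2, h2⟩ := bw_piece hD hDc (hX.inter hYm) hd (fun ζ hζ => hXd ζ hζ.1) hr0 hr1 a1 a2 a3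
      (fun ζ hζ => hζ.2)
    refine ⟨C2 + C1, by positivity, fun N => ?_⟩
    obtain ⟨q1, hq1, hq1'⟩ := h1 N
    obtain ⟨q2, hq2, hq2'⟩ := h2 N
    refine ⟨q2 + q1, (Polynomial.degree_add_le _ _).trans (max_le hq2 hq1), fun z hz => ?_⟩
    rw [← integral_inter_add_sdiff hYm (hI z).integrableOn, Polynomial.eval_add, add_sub_add_comm, add_mul]
    exact (norm_add_le _ _).trans (add_le_add (hq2' z hz) (hq1' z hz))


open MeasureTheory Manifold in
theorem bw_poly {L K0 P : Set ℂ} (hLc : IsCompact L) {s : ℝ} (hs : 0 < s)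
    (hL : ∀ a ∈ L, ∃ C ⊆ L, IsPreconnected C ∧ a ∈ C ∧ ∃ b ∈ C, s ≤ dist b a)
    (hLu : L = K0 ∪ P) (hK0 : IsPreconnected K0) (hnt : K0.Nontrivial)
    {F : ℂ → ℂ} (hF0 : ∀ z ∈ K0, F z = 0) (hF1 : ∀ z ∈ P, F z ≠ 0)
    {r1 r : ℝ} (h1 : 0 < r1) (h12 : r1 < r)
    {N : ℕ} {p : ℕ → Polynomial ℂ} (hp : ∀ n, N ≤ n → (p n).degree ≤ (n : ℕ))
    (hpF : ∀ n, N ≤ n → ∀ z ∈ L, ‖F z - (p n).eval z‖ ≤ r1 ^ n) (hr1 : r < 1) :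
    ∃ C : ℝ, 0 ≤ C ∧ ∀ N : ℕ, ∃ q : Polynomial ℂ, q.degree ≤ (N : ℕ) ∧
      (∀ z ∈ K0, ‖q.eval z‖ ≤ C * r ^ N) ∧ (∀ z ∈ P, ‖q.eval z - 1‖ ≤ C * r ^ N) := by
  have hr0 : 0 < r := h1.trans h12
  obtain ⟨U, G, hU, hSU, hG, hGF⟩ := ext_holo hs hL h1 h12 hp hpF hr1
  have hLS : L ⊆ SS L (1 / r) := SS_sub ((one_le_div hr0).2 hr1.le)
  have hKL : K0 ⊆ L := by rw [hLu]; exact Set.subset_union_left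
  have hPL : P ⊆ L := by rw [hLu]; exact Set.subset_union_right
  obtain ⟨V0, V1, hV0, hV1, hdis, hUV, hKV, hPV⟩ := sep_open hU hG hK0 hnt (hKL.trans (hLS.trans hSU))
    (hPL.trans (hLS.trans hSU)) (fun z hz => by rw [hGF z (hKL hz), hF0 z hz])
    (fun z hz => by rw [hGF z (hPL hz)]; exact hF1 z hz)
  set S := SS L (1 / r) with hS
  have hSc : IsCompact S := SS_compact hLc _
  have hS1c : IsCompact (S \ V0) := hSc.diff hV0
  have hS1V : S \ V0 ⊆ V1 := fun z hz => (hUV (hSU hz.1)).resolve_left hz.2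
  obtain ⟨t, htc, ht1, ht2⟩ := exists_compact_between hS1c hV1 hS1V
  obtain ⟨ψ0, hψ1, hψ0, -⟩ := exists_contMDiffMap_one_nhds_of_subset_interior 𝓘(ℝ, ℂ) (n := 1)
    hS1c.isClosed ht1
  have hψs : ContDiff ℝ 1 ψ0 := ψ0.contMDiff.contDiff
  set ψ : ℂ → ℂ := fun z => (ψ0 z : ℂ) with hψ
  have hψd : ContDiff ℝ 1 ψ := Complex.ofRealCLM.contDiff.comp hψs
  have hψsup : tsupport ψ ⊆ t := by
    refine closure_minimal ?_ htc.isClosed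
    intro z hz
    by_contra h
    exact hz (by simp [hψ, hψ0 z h])
  have hψc : HasCompactSupport ψ := htc.of_isClosed_subset (isClosed_tsupport _) hψsup
  set D := dbar ψ with hD
  have hDf := hψd.continuous_fderiv one_ne_zero
  have hDcont : Continuous D := by rw [hD]; unfold dbar; fun_prop
  have hDsub : tsupport D ⊆ tsupport ψ := by
    refine closure_minimal ?_ (isClosed_tsupport _)
    intro z hz
    by_contra h
    apply hz
    have : ψ =ᶠ[𝓝 z] fun _ => 0 := notMem_tsupport_iff_eventuallyEq.1 h
    simp [hD, dbar, this.fderiv_eq]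
  have hDc : HasCompactSupport D := hψc.of_isClosed_subset (isClosed_tsupport _) hDsub
  have hDS : ∀ ζ ∈ tsupport D, ζ ∉ S := by
    intro ζ hζ hζS
    have hζ1 : ζ ∈ V1 := ht2 (hψsup (hDsub hζ))
    have hζ2 : ζ ∈ S \ V0 := ⟨hζS, fun h => Set.disjoint_left.1 hdis h hζ1⟩
    have h3 : ∀ᶠ x in 𝓝 ζ, ψ0 x = 1 := (eventually_nhdsSet_iff_forall.1 hψ1) ζ hζ2
    have h4 : D =ᶠ[𝓝 ζ] 0 := by
      filter_upwards [h3.eventually_nhds] with x hx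
      have : ψ =ᶠ[𝓝 x] fun _ => 1 := hx.mono fun y hy => by simp [hψ, hy]
      simp [hD, dbar, this.fderiv_eq]
    exact notMem_tsupport_iff_eventuallyEq.2 h4 hζ
  obtain ⟨a0, ha0⟩ : L.Nonempty := hnt.nonempty.mono hKL
  set I : Set (ℕ × Polynomial ℂ) := {x | 1 ≤ x.1 ∧ x.2.degree ≤ (x.1 : ℕ) ∧ ∀ z ∈ L, ‖x.2.eval z‖ ≤ 1} with hI
  have hcov : tsupport D ⊆ ⋃ x ∈ I, {ζ : ℂ | (1 / r) ^ x.1 < ‖x.2.eval ζ‖} := by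
    intro ζ hζ
    have := hDS ζ hζ
    simp only [hS, SS, Set.mem_ofPred_eq] at this
    push Not at this
    obtain ⟨n, e, he1, he2, he3⟩ := this
    simp only [Set.mem_iUnion]
    refine ⟨(n, e), ⟨?_, he1, he2⟩, he3⟩
    by_contra hn
    have hn0 : n = 0 := by simp at hn; exact hn
    subst hn0
    have : e = Polynomial.C (e.coeff 0) := Polynomial.eq_C_of_degree_le_zero (by simpa using he1)
    rw [this] at he2 he3
    have := he2 a0 ha0
    simp only [Polynomial.eval_C, pow_zero] at this he3
    linarith
  obtain ⟨b, hb1, hb2, hb3⟩ := hDc.isCompact.elim_finite_subcover_image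
    (fun x _ => isOpen_lt continuous_const (by fun_prop)) hcov
  obtain ⟨d, hd, hdd⟩ : ∃ d : ℝ, 0 < d ∧ ∀ ζ ∈ tsupport D, ∀ z ∈ L, d ≤ ‖z - ζ‖ := by
    have hdj : Disjoint (tsupport D) L := Set.disjoint_left.2 fun ζ h1 h2 => hDS ζ h1 (hLS h2)
    obtain ⟨d, hd, h⟩ := Metric.exists_pos_forall_lt_edist hDc.isCompact hLc.isClosed hdj
    refine ⟨d, hd, fun ζ hζ z hz => ?_⟩
    have := h ζ hζ z hz
    rw [edist_nndist, ENNReal.coe_lt_coe] at this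
    have h5 : (d : ℝ) < dist ζ z := this
    rw [dist_comm, dist_eq_norm] at h5
    exact h5.le
  obtain ⟨C, hC, hq⟩ := bw_sum (L := L) hDcont hDc hd hr0 hr1 hb2.toFinset (fun x hx => hb1 (by simpa using hx))
    (tsupport D) (isClosed_tsupport _).measurableSet hdd (by
      intro ζ hζ
      have := hb3 hζ
      simp only [Set.mem_iUnion] at this
      obtain ⟨x, hx, hx2⟩ := this
      exact ⟨x, by simpa using hx, hx2⟩)
  have hpi := Real.pi_pos
  have hpi' : (Real.pi : ℂ) ≠ 0 := by exact_mod_cast hpi.ne'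
  have e1 : ∀ z, ∫ ζ in tsupport D, D ζ * (z - ζ)⁻¹ = Real.pi * ψ z := by
    intro z
    rw [setIntegral_eq_integral_of_forall_compl_eq_zero]
    · have := pompeiu hψd hψc z
      have e : (fun ζ => D ζ * (z - ζ)⁻¹) = fun ζ => - (D ζ * (ζ - z)⁻¹) := by
        ext ζ; rw [← neg_sub ζ z, inv_neg]; ring
      rw [e, integral_neg, this, neg_neg]
    · intro ζ hζ
      rw [image_eq_zero_of_notMem_tsupport hζ, zero_mul]
  refine ⟨C / Real.pi, by positivity, fun n => ?_⟩
  obtain ⟨q, hq1, hq2⟩ := hq n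
  have key : ∀ z ∈ L, ‖(Polynomial.C (Real.pi : ℂ)⁻¹ * q).eval z - ψ z‖ ≤ C / Real.pi * r ^ n := by
    intro z hz
    have h := hq2 z hz
    rw [e1] at h
    have : (Polynomial.C (Real.pi : ℂ)⁻¹ * q).eval z - ψ z = (q.eval z - Real.pi * ψ z) / Real.pi := by
      rw [Polynomial.eval_mul, Polynomial.eval_C]; field_simp
    rw [this, norm_div, Complex.norm_real, Real.norm_of_nonneg hpi.le, div_mul_eq_mul_div]
    gcongr
  refine ⟨Polynomial.C (Real.pi : ℂ)⁻¹ * q, by rwa [Polynomial.degree_C_mul (inv_ne_zero hpi')], ?_, ?_⟩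
  · intro z hz
    have h := key z (hKL hz)
    have : ψ z = 0 := by
      have : z ∉ t := fun h => Set.disjoint_left.1 hdis (hKV hz) (ht2 h)
      simp [hψ, hψ0 z this]
    rwa [this, sub_zero] at h
  · intro z hz
    have h := key z (hPL hz)
    have : ψ z = 1 := by
      have : z ∈ S \ V0 := ⟨hLS (hPL hz), fun h => Set.disjoint_left.1 hdis h (hPV hz)⟩
      have := ((eventually_nhdsSet_iff_forall.1 hψ1) z this).self_of_nhds
      simp [hψ, this]
    rwa [this] at h


theorem le_supNorm {g : ℂ → ℂ} {X : Set ℂ} {M : ℝ} (hM : ∀ z ∈ X, ‖g z‖ ≤ M) {z : ℂ} (hz : z ∈ X) :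
    ‖g z‖ ≤ supNorm g X := by
  refine le_csSup ⟨M, ?_⟩ ⟨z, hz, rfl⟩
  rintro _ ⟨w, hw, rfl⟩
  exact hM w hw

theorem le_supNorm_c {g : ℂ → ℂ} {X : Set ℂ} (hX : IsCompact X) (hg : ContinuousOn g X) {z : ℂ} (hz : z ∈ X) :
    ‖g z‖ ≤ supNorm g X := by
  obtain ⟨M, hM⟩ := hX.exists_bound_of_continuousOn hg
  exact le_supNorm hM hz

theorem supNorm_le {g : ℂ → ℂ} {X : Set ℂ} {M : ℝ} (hM0 : 0 ≤ M) (hM : ∀ z ∈ X, ‖g z‖ ≤ M) :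
    supNorm g X ≤ M := by
  refine Real.sSup_le ?_ hM0
  rintro _ ⟨w, hw, rfl⟩
  exact hM w hw

theorem supNorm_nonneg (g : ℂ → ℂ) (X : Set ℂ) : 0 ≤ supNorm g X := by
  refine Real.sSup_nonneg ?_
  rintro _ ⟨w, hw, rfl⟩
  exact norm_nonneg _

theorem rho_extract {L : Set ℂ} {F : ℂ → ℂ} {M : ℝ} (hM : ∀ z ∈ L, ‖F z‖ ≤ M) (hL : IsCompact L) {r : ℝ}
    (hr0 : 0 < r) (hr : rho L F < r) :
    ∃ (N : ℕ) (p : ℕ → Polynomial ℂ), (∀ n, N ≤ n → (p n).degree ≤ (n : ℕ)) ∧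
      ∀ n, N ≤ n → ∀ z ∈ L, ‖F z - (p n).eval z‖ ≤ r ^ n := by
  set M' := max M 1 with hM'
  have hM'1 : 1 ≤ M' := le_max_right _ _
  have hd0 : ∀ n, 0 ≤ dApprox L F n := by
    intro n
    refine Real.sInf_nonneg ?_
    rintro _ ⟨p, _, rfl⟩
    exact supNorm_nonneg _ _
  have hd1 : ∀ n, dApprox L F n ≤ M' := by
    intro n
    have hmem : supNorm (fun z => F z - Polynomial.eval z 0) L ∈ {c : ℝ | ∃ p : Polynomial ℂ,
        p.degree ≤ (n : ℕ) ∧ c = supNorm (fun z => F z - Polynomial.eval z p) L} := ⟨0, by simp, rfl⟩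
    refine (csInf_le ⟨0, ?_⟩ hmem).trans (supNorm_le (by linarith) fun z hz => ?_)
    · rintro _ ⟨p, _, rfl⟩
      exact supNorm_nonneg _ _
    · rw [Polynomial.eval_zero, sub_zero]; exact (hM z hz).trans (le_max_left _ _)
  have hb : IsBoundedUnder (· ≤ ·) atTop (fun n : ℕ => dApprox L F n ^ (1 / (n : ℝ))) := by
    refine ⟨M', ?_⟩
    rw [eventually_map]
    filter_upwards [eventually_ge_atTop 1] with n hn
    have hn' : (1:ℝ) ≤ n := by exact_mod_cast hn
    calc dApprox L F n ^ (1 / (n : ℝ)) ≤ M' ^ (1 / (n : ℝ)) := by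
          exact Real.rpow_le_rpow (hd0 n) (hd1 n) (by positivity)
      _ ≤ M' ^ (1 : ℝ) := Real.rpow_le_rpow_of_exponent_le hM'1 (by rw [div_le_one (by linarith)]; exact hn')
      _ = M' := Real.rpow_one _
  have hev := eventually_lt_of_limsup_lt hr hb
  have hev2 : ∀ᶠ n : ℕ in atTop, ∃ p : Polynomial ℂ, p.degree ≤ (n : ℕ) ∧ ∀ z ∈ L, ‖F z - p.eval z‖ ≤ r ^ n := by
    filter_upwards [hev, eventually_ge_atTop 1] with n hn hn1
    have hn0 : n ≠ 0 := by omega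
    have h1 : dApprox L F n < r ^ n := by
      have := pow_lt_pow_left₀ hn (Real.rpow_nonneg (hd0 n) _) hn0
      rwa [one_div, Real.rpow_inv_natCast_pow (hd0 n) hn0] at this
    have hmem : supNorm (fun z => F z - Polynomial.eval z 0) L ∈ {c : ℝ | ∃ p : Polynomial ℂ,
        p.degree ≤ (n : ℕ) ∧ c = supNorm (fun z => F z - Polynomial.eval z p) L} := ⟨0, by simp, rfl⟩
    obtain ⟨_, ⟨p, hp, rfl⟩, h2⟩ := exists_lt_of_csInf_lt ⟨_, hmem⟩ h1
    refine ⟨p, hp, fun z hz => ?_⟩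
    obtain ⟨B, hB⟩ := hL.exists_bound_of_continuousOn (f := fun z => p.eval z) (by fun_prop)
    exact (le_supNorm (g := fun z => F z - p.eval z) (M := M + B)
      (fun w hw => (norm_sub_le _ _).trans (add_le_add (hM w hw) (hB w hw))) hz).trans h2.le
  obtain ⟨N, hN⟩ := eventually_atTop.1 hev2
  choose! p hp using hN
  exact ⟨N, p, fun n hn => (hp n hn).1, fun n hn => (hp n hn).2⟩

theorem poly_iter (f : Polynomial ℂ) (k : ℕ) :
    iteratedDeriv k (fun z => f.eval z) = fun z => (Polynomial.derivative^[k] f).eval z := by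
  induction k with
  | zero => simp
  | succ k ih =>
    rw [iteratedDeriv_succ, ih]
    ext z
    rw [Polynomial.deriv, Function.iterate_succ_apply']

theorem taylor_poly (f : Polynomial ℂ) {n : ℕ} (hn : f.natDegree ≤ n) (z₀ z : ℂ) :
    taylorSum (fun z => f.eval z) z₀ n z = f.eval z := by
  have h := congrArg (Polynomial.eval z) (Polynomial.sum_taylor_eq f z₀)
  rw [Polynomial.sum_over_range' _ (by simp) (n + 1) (by rw [Polynomial.natDegree_taylor]; omega),
    Polynomial.eval_finsetSum] at h
  rw [← h, taylorSum]
  refine Finset.sum_congr rfl fun k _ => ?_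
  rw [poly_iter, ← Polynomial.factorial_smul_hasseDeriv, Polynomial.taylor_coeff]
  have : (k.factorial : ℂ) ≠ 0 := by exact_mod_cast k.factorial_ne_zero
  simp
  left
  field_simp

theorem taylor_congr {f g : ℂ → ℂ} {z₀ : ℂ} (h : f =ᶠ[𝓝 z₀] g) (n : ℕ) (z : ℂ) :
    taylorSum f z₀ n z = taylorSum g z₀ n z := by
  simp only [taylorSum]
  refine Finset.sum_congr rfl fun k _ => ?_
  rw [h.iteratedDeriv_eq k]

theorem taylor_diff {K : Set ℂ} (hK : IsCompact K) {f g : ℂ → ℂ} (hf : memA K f) (hg : memA K g) {z₀ : ℂ}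
    {ρ : ℝ} (hρ : 0 < ρ) (hb : closedBall z₀ ρ ⊆ interior K) {R : ℝ} (n : ℕ) {z : ℂ} (hz : ‖z - z₀‖ ≤ R) :
    ‖taylorSum g z₀ n z - taylorSum f z₀ n z‖ ≤
      (∑ k ∈ Finset.range (n + 1), (R / ρ) ^ k) * supNorm (fun z => g z - f z) K := by
  rw [taylorSum, taylorSum, ← Finset.sum_sub_distrib, Finset.sum_mul]
  refine norm_sum_le_of_le _ fun k _ => ?_
  have hz0 : interior K ∈ 𝓝 z₀ := isOpen_interior.mem_nhds (hb (mem_closedBall_self hρ.le))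
  have cg : ContDiffAt ℂ k g z₀ := (hg.2.analyticAt hz0).contDiffAt
  have cf : ContDiffAt ℂ k f z₀ := (hf.2.analyticAt hz0).contDiffAt
  have e : iteratedDeriv k g z₀ / (k.factorial) * (z - z₀) ^ k - iteratedDeriv k f z₀ / (k.factorial) * (z - z₀) ^ k
      = iteratedDeriv k (g - f) z₀ / (k.factorial) * (z - z₀) ^ k := by
    rw [iteratedDeriv_sub cg cf]; ring
  have hd : DifferentiableOn ℂ (g - f) (interior K) := hg.2.sub hf.2
  have hC := Complex.norm_iteratedDeriv_le_of_forall_mem_sphere_norm_le (f := g - f) (c := z₀) (R := ρ)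
    (C := supNorm (fun z => g z - f z) K) k hρ
    ((hd.mono (by rw [closure_ball _ hρ.ne']; exact hb)).diffContOnCl) (fun w hw => by
      exact le_supNorm_c (g := fun z => g z - f z) hK (hg.1.sub hf.1) (interior_subset (hb (sphere_subset_closedBall hw))))
  have hfac : (0:ℝ) < k.factorial := by exact_mod_cast k.factorial_pos
  rw [e, norm_mul, norm_div, norm_pow, Complex.norm_natCast]
  calc _ ≤ (k.factorial * supNorm (fun z => g z - f z) K / ρ ^ k) / k.factorial * R ^ k := by
          have hsn := supNorm_nonneg (fun z => g z - f z) K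
          gcongr
    _ = _ := by rw [div_pow]; field_simp


theorem glue_memA {K0 P : Set ℂ} (hK : IsCompact K0) (hP : IsCompact P) (hd : Disjoint K0 P)
    {g h : ℂ → ℂ} (hg : memA K0 g) (hh : memA P h) :
    ∃ H : ℂ → ℂ, memA (K0 ∪ P) H ∧ (∀ z ∈ K0, H z = g z) ∧ ∀ z ∈ P, H z = h z := by
  classical
  set H : ℂ → ℂ := fun z => if z ∈ K0 then g z else h z with hH
  have h1 : ∀ z ∈ K0, H z = g z := fun z hz => by simp [hH, hz]
  have h2 : ∀ z ∈ P, H z = h z := fun z hz => by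
    have : z ∉ K0 := fun h => Set.disjoint_left.1 hd h hz
    simp [hH, this]
  refine ⟨H, ⟨?_, ?_⟩, h1, h2⟩
  · exact (hg.1.congr h1).union_of_isClosed (hh.1.congr h2) hK.isClosed hP.isClosed
  · intro z hz
    have key : ∀ A B : Set ℂ, IsClosed B → A ∪ B = K0 ∪ P → z ∉ B → ∀ φ, memA A φ → (∀ w ∈ A, H w = φ w) →
        DifferentiableAt ℂ H z := by
      intro A B hB hAB hzB φ hφ hHφ
      have hA : A ∈ 𝓝 z := by
        filter_upwards [mem_interior_iff_mem_nhds.1 hz, hB.isOpen_compl.mem_nhds hzB] with w hw hw2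
        rw [← hAB] at hw
        exact hw.resolve_right hw2
      have hzi : z ∈ interior A := mem_interior_iff_mem_nhds.2 hA
      have := hφ.2.differentiableAt (isOpen_interior.mem_nhds hzi)
      refine this.congr_of_eventuallyEq ?_
      filter_upwards [hA] with w hw using hHφ w hw
    refine DifferentiableAt.differentiableWithinAt ?_
    rcases interior_subset hz with hz1 | hz1
    · exact key K0 P hP.isClosed rfl (fun h => Set.disjoint_left.1 hd hz1 h) g hg h1
    · exact key P K0 hK.isClosed (Set.union_comm _ _) (fun h => Set.disjoint_left.1 hd h hz1) h hh h2

theorem key_approx {K0 P : Set ℂ} (hK : IsCompact K0) (hP : IsCompact P) (hd : Disjoint K0 P)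
    (hLc : IsConnected (K0 ∪ P)ᶜ) {C r : ℝ} (hC : 0 ≤ C) (hr0 : 0 < r) (hr1 : r < 1)
    (hq : ∀ N : ℕ, ∃ q : Polynomial ℂ, q.degree ≤ (N : ℕ) ∧
      (∀ z ∈ K0, ‖q.eval z‖ ≤ C * r ^ N) ∧ (∀ z ∈ P, ‖q.eval z - 1‖ ≤ C * r ^ N))
    {β : ℕ → ℂ} {a : ℝ} (hra : r < a) (har : a < 1 / r)
    (hcl : MapClusterPt a Filter.atTop (fun n : ℕ => ‖β n‖ ^ (1 / (n : ℝ))))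
    {g h : ℂ → ℂ} (hg : memA K0 g) (hh : memA P h) {ε : ℝ} (hε : 0 < ε) :
    ∃ (n : ℕ) (f : Polynomial ℂ), 1 ≤ n ∧ f.natDegree ≤ n ∧ (∀ z ∈ K0, ‖f.eval z - g z‖ ≤ ε) ∧
      ∀ z ∈ P, ‖β n * f.eval z - h z‖ ≤ ε := by
  obtain ⟨H, hH, hH1, hH2⟩ := glue_memA hK hP hd hg hh
  have hLcomp : IsCompact (K0 ∪ P) := hK.union hP
  obtain ⟨p, hp⟩ := mergelyan hLcomp hLc hH (ε / 2) (by positivity)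
  obtain ⟨B, hB0, hB⟩ := (PA.poly (K0 ∪ P) p).bdd hLcomp
  obtain ⟨c1, hc1, hc1'⟩ := exists_between hra
  obtain ⟨c2, hc2, hc2'⟩ := exists_between har
  have hc10 : 0 < c1 := hr0.trans hc1
  have hc20 : 0 < c2 := hc10.trans (hc1'.trans hc2)
  set d := p.natDegree with hdd
  have hlim : Tendsto (fun n : ℕ => B * C / r ^ d * (r ^ n + (r / c1) ^ n + (r * c2) ^ n)) atTop (𝓝 0) := by
    have t1 := tendsto_pow_atTop_nhds_zero_of_lt_one hr0.le hr1
    have t2 := tendsto_pow_atTop_nhds_zero_of_lt_one (r := r / c1) (by positivity) ((div_lt_one hc10).2 hc1)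
    have t3 := tendsto_pow_atTop_nhds_zero_of_lt_one (r := r * c2) (by positivity) (by
      rw [lt_div_iff₀ hr0] at hc2'; linarith)
    simpa using ((t1.add t2).add t3).const_mul (B * C / r ^ d)
  have hev : ∀ᶠ n : ℕ in atTop, B * C / r ^ d * (r ^ n + (r / c1) ^ n + (r * c2) ^ n) ≤ ε / 2 :=
    hlim.eventually_le_const (by positivity)
  have hfr := hcl.frequently (Ioo_mem_nhds hc1' hc2)
  obtain ⟨n, ⟨hb1, hb2⟩, hn1, hnd, hnE⟩ := (hfr.and_eventually ((eventually_ge_atTop 1).and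
    ((eventually_ge_atTop d).and hev))).exists
  have hn0 : n ≠ 0 := by omega
  have hβ1 : c1 ^ n < ‖β n‖ := by
    have := pow_lt_pow_left₀ hb1 hc10.le hn0
    rwa [one_div, Real.rpow_inv_natCast_pow (norm_nonneg _) hn0] at this
  have hβ2 : ‖β n‖ < c2 ^ n := by
    have := pow_lt_pow_left₀ hb2 (Real.rpow_nonneg (norm_nonneg _) _) hn0
    rwa [one_div, Real.rpow_inv_natCast_pow (norm_nonneg _) hn0] at this
  have hβp : 0 < ‖β n‖ := lt_trans (by positivity) hβ1
  have hβ0 : β n ≠ 0 := norm_pos_iff.1 hβp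
  obtain ⟨q, hq1, hqK, hqP⟩ := hq (n - d)
  have hrp : r ^ (n - d) = r ^ n / r ^ d := by
    rw [eq_div_iff (by positivity), ← pow_add, Nat.sub_add_cancel hnd]
  rw [← Polynomial.natDegree_le_iff_degree_le] at hq1
  have hEpos : 0 ≤ B * C / r ^ d := by positivity
  refine ⟨n, p + p * (Polynomial.C ((β n)⁻¹ - 1) * q), hn1, ?_, ?_, ?_⟩
  · refine (Polynomial.natDegree_add_le _ _).trans (max_le hnd ?_)
    refine Polynomial.natDegree_mul_le.trans ?_
    have := Polynomial.natDegree_C_mul_le ((β n)⁻¹ - 1) q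
    omega
  · intro z hz
    have hzL : z ∈ K0 ∪ P := Or.inl hz
    have h1 := hp z hzL
    rw [hH1 z hz] at h1
    have e : (p + p * (Polynomial.C ((β n)⁻¹ - 1) * q)).eval z - g z =
        p.eval z * (((β n)⁻¹ - 1) * q.eval z) - (g z - p.eval z) := by
      simp only [Polynomial.eval_add, Polynomial.eval_mul, Polynomial.eval_C]; ring
    rw [e]
    refine (norm_sub_le _ _).trans ?_
    have h2 : ‖p.eval z * (((β n)⁻¹ - 1) * q.eval z)‖ ≤ ε / 2 := by
      refine le_trans ?_ hnE
      rw [norm_mul, norm_mul]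
      have h3 : ‖(β n)⁻¹ - 1‖ ≤ (c1 ^ n)⁻¹ + 1 := by
        refine (norm_sub_le _ _).trans ?_
        rw [norm_inv, norm_one]
        gcongr
      calc _ ≤ B * (((c1 ^ n)⁻¹ + 1) * (C * r ^ (n - d))) := by
            gcongr
            · exact hB z hzL
            · exact hqK z hz
        _ = B * C / r ^ d * (r ^ n + (r / c1) ^ n) := by
            rw [hrp, div_pow]; field_simp; ring
        _ ≤ _ := by
            apply mul_le_mul_of_nonneg_left _ hEpos
            have : 0 ≤ (r * c2) ^ n := by positivity
            linarith
    linarith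
  · intro z hz
    have hzL : z ∈ K0 ∪ P := Or.inr hz
    have h1 := hp z hzL
    rw [hH2 z hz] at h1
    have e : β n * (p + p * (Polynomial.C ((β n)⁻¹ - 1) * q)).eval z - h z =
        p.eval z * ((1 - β n) * (q.eval z - 1)) - (h z - p.eval z) := by
      simp only [Polynomial.eval_add, Polynomial.eval_mul, Polynomial.eval_C]; field_simp; ring
    rw [e]
    refine (norm_sub_le _ _).trans ?_
    have h2 : ‖p.eval z * ((1 - β n) * (q.eval z - 1))‖ ≤ ε / 2 := by
      refine le_trans ?_ hnE
      rw [norm_mul, norm_mul]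
      have h3 : ‖1 - β n‖ ≤ 1 + c2 ^ n := by
        refine (norm_sub_le _ _).trans ?_
        rw [norm_one]
        gcongr
      calc _ ≤ B * ((1 + c2 ^ n) * (C * r ^ (n - d))) := by
            gcongr
            · exact hB z hzL
            · exact hqP z hz
        _ = B * C / r ^ d * (r ^ n + (r * c2) ^ n) := by
            rw [hrp, mul_pow]; field_simp
        _ ≤ _ := by
            gcongr
            have : 0 ≤ (r / c1) ^ n := by positivity
            linarith
    linarith

open Classical in
noncomputable def extA (X : Set ℂ) (φ : C(X, ℂ)) : ℂ → ℂ := fun z => if h : z ∈ X then φ ⟨z, h⟩ else 0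

def AA (X : Set ℂ) : Set C(X, ℂ) := {φ | DifferentiableOn ℂ (extA X φ) (interior X)}

theorem extA_apply {X : Set ℂ} (φ : C(X, ℂ)) {z : ℂ} (hz : z ∈ X) : extA X φ z = φ ⟨z, hz⟩ := by
  simp [extA, hz]

theorem extA_memA {X : Set ℂ} {φ : C(X, ℂ)} (h : φ ∈ AA X) : memA X (extA X φ) := by
  refine ⟨?_, h⟩
  rw [continuousOn_iff_continuous_restrict]
  convert φ.continuous using 1
  ext z
  simp [extA]

theorem exists_AA {X : Set ℂ} {f : ℂ → ℂ} (hf : memA X f) : ∃ φ ∈ AA X, ∀ z ∈ X, extA X φ z = f z := by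
  refine ⟨⟨_, hf.1.domRestrict⟩, ?_, ?_⟩
  · refine hf.2.congr fun z hz => ?_
    rw [extA_apply _ (interior_subset hz)]; rfl
  · intro z hz
    rw [extA_apply _ hz]; rfl

theorem AA_closed {X : Set ℂ} (hX : IsCompact X) [CompactSpace X] : IsClosed (AA X) := by
  rw [← isSeqClosed_iff_isClosed]
  intro u φ hu hφ
  have ht : TendstoUniformlyOn (fun n => extA X (u n)) (extA X φ) atTop (interior X) := by
    rw [Metric.tendstoUniformlyOn_iff]
    intro ε hε
    filter_upwards [Metric.tendsto_nhds.1 hφ ε hε] with n hn z hz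
    rw [extA_apply _ (interior_subset hz), extA_apply _ (interior_subset hz), dist_comm]
    exact (ContinuousMap.dist_apply_le_dist _).trans_lt hn
  exact ht.tendstoLocallyUniformlyOn.differentiableOn (Eventually.of_forall fun n => hu n) isOpen_interior


theorem taylor_cont (f : ℂ → ℂ) (z₀ : ℂ) (n : ℕ) : Continuous (fun z => taylorSum f z₀ n z) := by
  unfold taylorSum
  fun_prop

def Vset (z₀ : ℂ) (P : Set ℂ) (β : ℕ → ℂ) (h : ℂ → ℂ) (ε : ℝ) : Set (ℂ → ℂ) :=
  {f | ∃ n : ℕ, 1 ≤ n ∧ supNorm (fun z => β n * taylorSum f z₀ n z - h z) P < ε}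

theorem Vset_open {K P : Set ℂ} (hK : IsCompact K) (hP : IsCompact P) {z₀ : ℂ} (hz₀ : z₀ ∈ interior K)
    (β : ℕ → ℂ) {h : ℂ → ℂ} (hh : ContinuousOn h P) (ε : ℝ) : openInA K (Vset z₀ P β h ε) := by
  rintro f ⟨n, hn, hlt⟩ hf
  obtain ⟨ρ, hρ, hb⟩ := Metric.nhds_basis_closedBall.mem_iff.1 (isOpen_interior.mem_nhds hz₀)
  obtain ⟨R, hR⟩ := hP.isBounded.subset_closedBall z₀
  have hR' : ∀ z ∈ P, ‖z - z₀‖ ≤ max R 0 := fun z hz => by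
    have := hR hz
    rw [mem_closedBall, dist_eq_norm] at this
    exact this.trans (le_max_left _ _)
  set R' := max R 0
  have hR0 : 0 ≤ R' := le_max_right _ _
  set S := ∑ k ∈ Finset.range (n + 1), (R' / ρ) ^ k
  have hS : 0 ≤ S := Finset.sum_nonneg fun k _ => by positivity
  set s := supNorm (fun z => β n * taylorSum f z₀ n z - h z) P with hs
  have hcont : ContinuousOn (fun z => β n * taylorSum f z₀ n z - h z) P :=
    ((continuous_const.mul (taylor_cont f z₀ n)).continuousOn).sub hh
  set A := ‖β n‖ * S + 1
  have hA : 0 < A := by positivity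
  refine ⟨(ε - s) / (2 * A), by apply div_pos (by linarith) (by positivity), ?_⟩
  intro g hg hgs
  refine ⟨n, hn, ?_⟩
  have hs0 : 0 ≤ s := supNorm_nonneg _ _
  set t := supNorm (fun z => g z - f z) K
  have ht0 : 0 ≤ t := supNorm_nonneg _ _
  have h1 : A * t ≤ (ε - s) / 2 := by
    rw [lt_div_iff₀ (by positivity)] at hgs
    nlinarith
  have h2 : supNorm (fun z => β n * taylorSum g z₀ n z - h z) P ≤ s + (ε - s) / 2 := by
    refine supNorm_le (by linarith) fun z hz => ?_
    have h3 := taylor_diff hK hf hg hρ hb n (hR' z hz)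
    have h4 := le_supNorm_c hP hcont hz
    have e : β n * taylorSum g z₀ n z - h z = (β n * taylorSum f z₀ n z - h z)
      + β n * (taylorSum g z₀ n z - taylorSum f z₀ n z) := by ring
    rw [e]
    refine (norm_add_le _ _).trans (add_le_add h4 ?_)
    rw [norm_mul]
    refine le_trans ?_ h1
    calc _ ≤ ‖β n‖ * (S * t) := by gcongr
      _ ≤ A * t := by simp only [A]; nlinarith
  linarith

theorem exists_seq {P : Set ℂ} (hP : IsCompact P) : ∃ h : ℕ → ℂ → ℂ, (∀ j, memA P (h j)) ∧
    ∀ g, memA P g → ∀ ε > (0:ℝ), ∃ j, ∀ z ∈ P, ‖h j z - g z‖ ≤ ε := by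
  haveI : CompactSpace P := isCompact_iff_compactSpace.1 hP
  obtain ⟨φ0, hφ0, -⟩ := exists_AA (X := P) (f := fun _ => 0) ⟨continuousOn_const, differentiableOn_const _⟩
  haveI : Nonempty (AA P) := ⟨⟨φ0, hφ0⟩⟩
  refine ⟨fun j => extA P (TopologicalSpace.denseSeq (AA P) j).1, fun j => extA_memA (TopologicalSpace.denseSeq (AA P) j).2, ?_⟩
  intro g hg ε hε
  obtain ⟨φ, hφ, hφg⟩ := exists_AA hg
  obtain ⟨j, hj⟩ := (TopologicalSpace.denseRange_denseSeq (AA P)).exists_dist_lt ⟨φ, hφ⟩ hε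
  refine ⟨j, fun z hz => ?_⟩
  change ‖extA P (TopologicalSpace.denseSeq (AA P) j).1 z - g z‖ ≤ ε
  rw [← hφg z hz, extA_apply _ hz, extA_apply _ hz, ← dist_eq_norm, dist_comm]
  exact (ContinuousMap.dist_apply_le_dist _).trans hj.le

theorem Uuniv_eq {K P : Set ℂ} (hP : IsCompact P) (z₀ : ℂ) (β : ℕ → ℂ) {h : ℕ → ℂ → ℂ}
    (hh : ∀ j, memA P (h j))
    (hd : ∀ g, memA P g → ∀ ε > (0:ℝ), ∃ j, ∀ z ∈ P, ‖h j z - g z‖ ≤ ε) :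
    Uuniv z₀ K P β = {f | memA K f} ∩
      ⋂ n : ℕ, Vset z₀ P β (h (Nat.unpair n).1) (1 / ((Nat.unpair n).2 + 1)) := by
  ext f
  constructor
  · rintro ⟨h1, h2⟩
    refine ⟨h1, Set.mem_iInter.2 fun n => ?_⟩
    exact h2 _ (hh _) _ (by positivity)
  · rintro ⟨h1, h2⟩
    refine ⟨h1, fun g hg ε hε => ?_⟩
    obtain ⟨j, hj⟩ := hd g hg (ε / 2) (by positivity)
    obtain ⟨k, hk⟩ := exists_nat_one_div_lt (show 0 < ε / 2 by positivity)
    have h3 := Set.mem_iInter.1 h2 (Nat.pair j k)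
    simp only [Nat.unpair_pair] at h3
    obtain ⟨n, hn, hlt⟩ := h3
    refine ⟨n, hn, ?_⟩
    have hcont : ContinuousOn (fun z => β n * taylorSum f z₀ n z - h j z) P :=
      ((continuous_const.mul (taylor_cont f z₀ n)).continuousOn).sub (hh j).1
    have : supNorm (fun z => β n * taylorSum f z₀ n z - g z) P ≤
        supNorm (fun z => β n * taylorSum f z₀ n z - h j z) P + ε / 2 := by
      refine supNorm_le (add_nonneg (supNorm_nonneg _ _) (by positivity)) fun z hz => ?_
      have h4 := le_supNorm_c hP hcont hz
      have e : β n * taylorSum f z₀ n z - g z = (β n * taylorSum f z₀ n z - h j z) + (h j z - g z) := by ring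
      rw [e]
      exact (norm_add_le _ _).trans (add_le_add h4 (hj z hz))
    linarith

theorem baire_dense {K : Set ℂ} (hK : IsCompact K) {V : ℕ → Set (ℂ → ℂ)}
    (hV : ∀ n, openInA K (V n))
    (hd : ∀ n g, memA K g → ∀ ε > (0:ℝ), ∃ φ ∈ AA K, extA K φ ∈ V n ∧ ∀ z ∈ K, ‖extA K φ z - g z‖ ≤ ε) :
    denseInA K ({f | memA K f} ∩ ⋂ n, V n) := by
  haveI : CompactSpace K := isCompact_iff_compactSpace.1 hK
  haveI : CompleteSpace (AA K) := (AA_closed hK).completeSpace_coe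
  set W : ℕ → Set (AA K) := fun n => {φ | extA K φ.1 ∈ V n} with hW
  have hWo : ∀ n, IsOpen (W n) := by
    intro n
    rw [Metric.isOpen_iff]
    intro φ hφ
    obtain ⟨ε, hε, h⟩ := hV n _ hφ (extA_memA φ.2)
    refine ⟨ε, hε, fun ψ hψ => h _ (extA_memA ψ.2) ?_⟩
    refine lt_of_le_of_lt (supNorm_le dist_nonneg fun z hz => ?_) hψ
    rw [extA_apply _ hz, extA_apply _ hz, ← dist_eq_norm]
    exact ContinuousMap.dist_apply_le_dist _
  have hWd : ∀ n, Dense (W n) := by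
    intro n
    rw [Metric.dense_iff]
    intro φ ε hε
    obtain ⟨ψ, hψ, h1, h2⟩ := hd n _ (extA_memA φ.2) (ε / 2) (by positivity)
    refine ⟨⟨ψ, hψ⟩, ?_, h1⟩
    rw [mem_ball]
    refine lt_of_le_of_lt (b := ε / 2) ?_ (by linarith)
    refine (ContinuousMap.dist_le (by positivity)).2 fun z => ?_
    have := h2 z.1 z.2
    rwa [extA_apply _ z.2, extA_apply _ z.2, ← dist_eq_norm] at this
  have hD := dense_iInter_of_isOpen_nat hWo hWd
  intro g hg ε hε
  obtain ⟨φ, hφ, hφg⟩ := exists_AA hg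
  obtain ⟨ψ, hψ, hdist⟩ := hD.exists_dist_lt ⟨φ, hφ⟩ hε
  refine ⟨extA K ψ.1, ⟨extA_memA ψ.2, Set.mem_iInter.2 fun n => Set.mem_iInter.1 hψ n⟩, ?_⟩
  rw [dist_comm] at hdist
  refine lt_of_le_of_lt (supNorm_le dist_nonneg fun z hz => ?_) hdist
  rw [← hφg z hz, extA_apply _ hz, extA_apply _ hz, ← dist_eq_norm]
  exact ContinuousMap.dist_apply_le_dist (f := ψ.1) (g := φ) _

theorem stmt3 (m₀ : ℕ) (hm : 1 ≤ m₀) (K : Fin (m₀ + 1) → Set ℂ)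
    (hKc : ∀ i, IsCompact (K i)) (hKconn : ∀ i, IsConnected (K i))
    (hKdisj : ∀ i j, i ≠ j → Disjoint (K i) (K j))
    (hK0 : (interior (K 0)).Nonempty) (hKnt : ∀ i, i ≠ 0 → (K i).Nontrivial)
    (L : Set ℂ) (hL : L = ⋃ i, K i) (hLcc : IsConnected Lᶜ)
    (P : Set ℂ) (hP : P = L \ K 0) (z₀ : ℂ) (hz₀ : z₀ ∈ interior (K 0))
    (F : ℂ → ℂ) (hF : ∀ i : Fin (m₀ + 1), ∀ z ∈ K i, F z = ((i : ℕ) : ℂ)) (β : ℕ → ℂ)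
    (hlim : ∃ a ∈ Set.Ioo (rho L F) (1 / rho L F),
      MapClusterPt a Filter.atTop (fun n : ℕ => ‖β n‖ ^ (1 / (n : ℝ)))) :
    (∃ V : ℕ → Set (ℂ → ℂ), (∀ n, openInA (K 0) (V n)) ∧
      Uuniv z₀ (K 0) P β = {f | memA (K 0) f} ∩ ⋂ n, V n) ∧
    denseInA (K 0) (Uuniv z₀ (K 0) P β) ∧
    (Uuniv z₀ (K 0) P β).Nonempty := by
  have hLcomp : IsCompact L := hL ▸ isCompact_iUnion hKc
  have hPeq : P = ⋃ i : {i : Fin (m₀ + 1) // i ≠ 0}, K i.1 := by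
    rw [hP, hL]
    ext z
    simp only [Set.mem_diff, Set.mem_iUnion]
    constructor
    · rintro ⟨⟨i, hi⟩, h0⟩
      exact ⟨⟨i, fun h => h0 (h ▸ hi)⟩, hi⟩
    · rintro ⟨⟨i, hi0⟩, hi⟩
      exact ⟨⟨i, hi⟩, fun h0 => Set.disjoint_left.1 (hKdisj i 0 hi0) hi h0⟩
  have hPc : IsCompact P := hPeq ▸ isCompact_iUnion fun i => hKc i.1
  have hd : Disjoint (K 0) P := by rw [hP]; exact Set.disjoint_sdiff_right
  have hsub : ∀ i, K i ⊆ L := fun i => hL ▸ Set.subset_iUnion K i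
  have hLu : L = K 0 ∪ P := by rw [hP, Set.union_diff_cancel (hsub 0)]
  have hnt0 : (K 0).Nontrivial := by
    have : (interior (K 0)).Nontrivial := by
      obtain ⟨ρ, hρ, hb⟩ := Metric.isOpen_iff.1 isOpen_interior z₀ hz₀
      refine ⟨z₀, hz₀, z₀ + ((ρ / 2 : ℝ) : ℂ), hb ?_, ?_⟩
      · rw [mem_ball, dist_eq_norm, add_sub_cancel_left, Complex.norm_real, Real.norm_eq_abs, abs_of_pos (by positivity)]
        linarith
      · intro h
        have h1 : ((ρ / 2 : ℝ) : ℂ) = 0 := by simpa using h.symm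
        rw [Complex.ofReal_eq_zero] at h1
        linarith
    exact this.mono interior_subset
  have hnt : ∀ i, (K i).Nontrivial := fun i => by
    by_cases h : i = 0
    · rw [h]; exact hnt0
    · exact hKnt i h
  choose x hx y hy hxy using hnt
  obtain ⟨i0, hi0⟩ := Finite.exists_min (fun i => dist (x i) (y i) / 2)
  have hs : 0 < dist (x i0) (y i0) / 2 := by have := dist_pos.2 (hxy i0); positivity
  have hLs : ∀ a ∈ L, ∃ C ⊆ L, IsPreconnected C ∧ a ∈ C ∧ ∃ b ∈ C, dist (x i0) (y i0) / 2 ≤ dist b a := by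
    intro a ha
    rw [hL] at ha
    obtain ⟨i, hi⟩ := Set.mem_iUnion.1 ha
    refine ⟨K i, hsub i, (hKconn i).isPreconnected, hi, ?_⟩
    have h1 := hi0 i
    have h2 := dist_triangle_right (x i) (y i) a
    by_cases h3 : dist (x i) (y i) / 2 ≤ dist (x i) a
    · exact ⟨x i, hx i, h1.trans h3⟩
    · exact ⟨y i, hy i, by push Not at h3; linarith⟩
  have hF0 : ∀ z ∈ K 0, F z = 0 := fun z hz => by rw [hF 0 z hz]; simp
  have hF1 : ∀ z ∈ P, F z ≠ 0 := fun z hz => by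
    rw [hPeq] at hz
    obtain ⟨⟨i, hi⟩, hz⟩ := Set.mem_iUnion.1 hz
    rw [hF i z hz]
    exact Nat.cast_ne_zero.2 fun h => hi (Fin.ext h)
  have hFM : ∀ z ∈ L, ‖F z‖ ≤ m₀ := fun z hz => by
    rw [hL] at hz
    obtain ⟨i, hz⟩ := Set.mem_iUnion.1 hz
    rw [hF i z hz, Complex.norm_natCast]
    exact_mod_cast Nat.lt_succ_iff.1 i.2
  obtain ⟨a, ⟨ha1, ha2⟩, hcl⟩ := hlim
  have ha0 : 0 ≤ a := by
    by_contra! h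
    have := hcl.frequently (Iio_mem_nhds h)
    obtain ⟨n, hn⟩ := this.exists
    have h2 : 0 ≤ ‖β n‖ ^ (1 / (n : ℝ)) := by positivity
    exact absurd hn (not_lt.2 h2)
  have hρ : 0 < rho L F := by
    by_contra! h
    have : 1 / rho L F ≤ 0 := one_div_nonpos.2 h
    linarith
  have hapos : 0 < a := hρ.trans ha1
  have ha3 : rho L F < 1 / a := by
    rw [lt_div_iff₀ hρ] at ha2
    rw [lt_div_iff₀ hapos]; linarith
  obtain ⟨r, hr1, hr2⟩ := exists_between (lt_min ha1 ha3)
  obtain ⟨r1, hr3, hr4⟩ := exists_between hr1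
  have hr1pos : 0 < r1 := hρ.trans hr3
  have hrpos : 0 < r := hr1pos.trans hr4
  have hra : r < a := hr2.trans_le (min_le_left _ _)
  have hra' : r < 1 / a := hr2.trans_le (min_le_right _ _)
  have har : a < 1 / r := by
    rw [lt_div_iff₀ hapos] at hra'
    rw [lt_div_iff₀ hrpos]; linarith
  have hrlt : r < 1 := by
    rw [lt_div_iff₀ hapos] at hra'
    by_contra! h
    nlinarith
  obtain ⟨N, p, hp, hpF⟩ := rho_extract hFM hLcomp hr1pos hr3
  obtain ⟨C, hC, hq⟩ := bw_poly hLcomp hs hLs hLu (hKconn 0).isPreconnected hnt0 hF0 hF1 hr1pos hr4 hp hpF hrlt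
  have hLcc' : IsConnected (K 0 ∪ P)ᶜ := hLu ▸ hLcc
  obtain ⟨h, hh, hhd⟩ := exists_seq hPc
  have hU := Uuniv_eq (K := K 0) hPc z₀ β hh hhd
  have hop : ∀ n : ℕ, openInA (K 0) (Vset z₀ P β (h (Nat.unpair n).1) (1 / ((Nat.unpair n).2 + 1))) :=
    fun n => Vset_open (hKc 0) hPc hz₀ β (hh _).1 _
  have hdense : denseInA (K 0) (Uuniv z₀ (K 0) P β) := by
    rw [hU]
    refine baire_dense (hKc 0) hop ?_
    intro n g hg ε hε
    set j := (Nat.unpair n).1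
    set k := (Nat.unpair n).2
    have hk : (0:ℝ) < 1 / ((k : ℝ) + 1) := by positivity
    obtain ⟨M, f, hM, hfd, hf1, hf2⟩ := key_approx (hKc 0) hPc hd hLcc' hC hrpos hrlt hq hra har hcl hg (hh j)
      (ε := min ε (1 / ((k : ℝ) + 1) / 2)) (lt_min hε (by positivity))
    obtain ⟨φ, hφ, hφf⟩ := exists_AA (X := K 0) (f := fun z => f.eval z)
      ⟨f.continuous.continuousOn, f.differentiable.differentiableOn⟩
    refine ⟨φ, hφ, ⟨M, hM, ?_⟩, fun z hz => ?_⟩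
    · refine lt_of_le_of_lt (b := 1 / ((k : ℝ) + 1) / 2) (supNorm_le (by positivity) fun z hz => ?_) (by linarith)
      have he : extA (K 0) φ =ᶠ[𝓝 z₀] fun z => f.eval z := by
        filter_upwards [isOpen_interior.mem_nhds hz₀] with w hw
        exact hφf w (interior_subset hw)
      rw [taylor_congr he, taylor_poly f hfd]
      exact (hf2 z hz).trans (min_le_right _ _)
    · rw [hφf z hz]
      exact (hf1 z hz).trans (min_le_left _ _)
  refine ⟨⟨_, hop, hU⟩, hdense, ?_⟩
  obtain ⟨f, hf, -⟩ := hdense (fun _ => 0) ⟨continuousOn_const, differentiableOn_const _⟩ 1 one_pos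
  exact ⟨f, hf⟩
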